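/- arXiv:1512.04979 — 4 statements merged into one kernel-verified Lean document; each statement's English description precedes it below -/
import Mathlib

section
/- Let D be a bounded self-adjoint operator on a complex Hilbert space H, let α > 0, A ≥ 0, B ≥ 0, and let g : ℝ → ℂ be a continuous function satisfying |g(s) − g(t)| ≤ A + B|s − t|^α for all real s, t. Let n be a natural number with n > α + 1/2, and let y be a bounded operator on H. Then ‖[g(D), y]‖ ≤ 2(A+B)·( ‖y‖ + √((n − α)/(2n − 2α − 1)) · ∑_{k=0}^{n} C(n,k) ‖ad_D^k(y)‖ ), where ad_D(y) = Dy − yD and ad_D^k denotes the k-fold iterated commutator, with ad_D^0(y) = y. -/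
open Finset in
theorem CE_sum_rpow (p : ℝ) (hp : 1 < p) (M : ℕ) :
    ∑ m ∈ Finset.range M, ((m : ℝ) + 1) ^ (-p) ≤ p / (p - 1) := by
  have key : ∀ M : ℕ, ∑ m ∈ Finset.range (M + 1), ((m : ℝ) + 1) ^ (-p)
      ≤ p / (p - 1) - ((M : ℝ) + 1) ^ (1 - p) / (p - 1) := by
    intro M
    have h1 : 0 < p - 1 := by linarith
    induction M with
    | zero => 
      simp only [zero_add, Finset.range_one, Finset.sum_singleton, Nat.cast_zero, Real.one_rpow]
      rw [div_sub_div_same, le_div_iff₀ h1]; linarith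
    | succ k ih =>
      rw [Finset.sum_range_succ]
      have hk : (0 : ℝ) < (k : ℝ) + 1 := by positivity
      have hk2 : (0 : ℝ) < (k : ℝ) + 2 := by positivity
      -- Bernoulli: (1 + 1/(k+1))^(1-p)... use (k+1)^(1-p) ≥ (k+2)^(1-p) + (p-1)(k+2)^(-p)
      have hb : ((k : ℝ) + 2) ^ (1 - p) + (p - 1) * ((k : ℝ) + 2) ^ (-p) ≤ ((k : ℝ) + 1) ^ (1 - p) := by
        have hq : 0 < ((k : ℝ) + 1) / (k + 2) := by positivity
        have hlog : Real.log (((k : ℝ) + 1) / (k + 2)) ≤ - (1 / ((k : ℝ) + 2)) := by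
          have := Real.log_le_sub_one_of_pos hq
          have h5 : ((k : ℝ) + 1) / (k + 2) - 1 = - (1 / ((k : ℝ) + 2)) := by field_simp; ring
          linarith
        have hexp : 1 + (p - 1) * (1 / ((k : ℝ) + 2)) ≤ (((k : ℝ) + 1) / (k + 2)) ^ (1 - p) := by
          rw [Real.rpow_def_of_pos hq]
          have := Real.add_one_le_exp (Real.log (((k : ℝ) + 1) / (k + 2)) * (1 - p))
          nlinarith
        rw [Real.div_rpow hk.le hk2.le, le_div_iff₀ (by positivity)] at hexp
        have h6 : ((k : ℝ) + 2) ^ (-p) = (1 / ((k : ℝ) + 2)) * ((k : ℝ) + 2) ^ (1 - p) := by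
          rw [show -p = (1 - p) - 1 by ring, Real.rpow_sub_one hk2.ne']; ring
        rw [h6]; linarith
      have : ((k : ℝ) + 1 + 1) = k + 2 := by ring
      push_cast
      rw [this]
      have h3 : ((k : ℝ) + 2) ^ (-p) ≤ (((k : ℝ) + 1) ^ (1 - p) - ((k : ℝ) + 2) ^ (1 - p)) / (p - 1) := by
        rw [le_div_iff₀ h1]; linarith
      rw [sub_div] at h3
      linarith
  rcases M with _ | M
  · simp; apply div_nonneg <;> linarith
  · refine (key M).trans ?_
    have : 0 ≤ ((M : ℝ) + 1) ^ (1 - p) / (p - 1) := div_nonneg (by positivity) (by linarith)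
    linarith

noncomputable def CE_F {H : Type*} [NormedAddCommGroup H] [InnerProductSpace ℂ H] [CompleteSpace H]
    (D : H →L[ℂ] H) (f : ℝ → ℂ) : H →L[ℂ] H := cfc (fun z : ℂ => f z.re) D

section
variable {H : Type*} [NormedAddCommGroup H] [InnerProductSpace ℂ H] [CompleteSpace H]
    {D : H →L[ℂ] H}

theorem CE_congr (_hD : IsSelfAdjoint D) {f g : ℝ → ℂ} (h : ∀ t : ℝ, |t| ≤ ‖D‖ → f t = g t) :
    CE_F D f = CE_F D g := by
  unfold CE_F
  apply cfc_congr
  intro z hz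
  apply h
  have h1 := spectrum.norm_le_norm_mul_of_mem hz
  have h2 : ‖(1 : H →L[ℂ] H)‖ ≤ 1 := ContinuousLinearMap.norm_id_le
  calc |z.re| ≤ ‖z‖ := Complex.abs_re_le_norm z
    _ ≤ ‖D‖ * ‖(1 : H →L[ℂ] H)‖ := h1
    _ ≤ ‖D‖ := by nlinarith [norm_nonneg D]

theorem CE_mul {f g : ℝ → ℂ} (hf : Continuous f) (hg : Continuous g) :
    CE_F D (fun t => f t * g t) = CE_F D f * CE_F D g := by
  unfold CE_F
  exact cfc_mul (fun z : ℂ => f z.re) (fun z : ℂ => g z.re) D (by fun_prop) (by fun_prop)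

theorem CE_add {f g : ℝ → ℂ} (hf : Continuous f) (hg : Continuous g) :
    CE_F D (fun t => f t + g t) = CE_F D f + CE_F D g := by
  unfold CE_F
  exact cfc_add D (fun z : ℂ => f z.re) (fun z : ℂ => g z.re) (by fun_prop) (by fun_prop)

theorem CE_sub {f g : ℝ → ℂ} (hf : Continuous f) (hg : Continuous g) :
    CE_F D (fun t => f t - g t) = CE_F D f - CE_F D g := by
  unfold CE_F
  exact cfc_sub (fun z : ℂ => f z.re) (fun z : ℂ => g z.re) D (by fun_prop) (by fun_prop)

theorem CE_pow (hD : IsSelfAdjoint D) {f : ℝ → ℂ} (hf : Continuous f) (m : ℕ) :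
    CE_F D (fun t => f t ^ m) = CE_F D f ^ m :=
  cfc_pow (fun z : ℂ => f z.re) m D (by fun_prop) hD.isStarNormal

theorem CE_star (f : ℝ → ℂ) : star (CE_F D f) = CE_F D (fun t => star (f t)) := by
  unfold CE_F
  exact (cfc_star (fun z : ℂ => f z.re) D).symm

theorem CE_const (hD : IsSelfAdjoint D) (c : ℂ) : CE_F D (fun _ => c) = c • 1 := by
  unfold CE_F
  rw [cfc_const c D hD.isStarNormal, Algebra.algebraMap_eq_smul_one]

theorem CE_id (hD : IsSelfAdjoint D) : CE_F D (fun t => (t : ℂ)) = D := by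
  unfold CE_F
  have : cfc (fun z : ℂ => ((z.re : ℝ) : ℂ)) D = cfc (fun z : ℂ => z) D := by
    apply cfc_congr
    intro z hz
    exact (hD.mem_spectrum_eq_re hz).symm
  rw [this]
  exact cfc_id' ℂ D hD.isStarNormal

theorem CE_comm (D : H →L[ℂ] H) (f g : ℝ → ℂ) : CE_F D f * CE_F D g = CE_F D g * CE_F D f :=
  cfc_commute_cfc (fun z : ℂ => f z.re) (fun z : ℂ => g z.re) D

theorem CE_inner (f : ℝ → ℂ) (u v : H) :
    inner ℂ (CE_F D f u) v = inner ℂ u (CE_F D (fun t => star (f t)) v) := by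
  rw [← CE_star, ContinuousLinearMap.star_eq_adjoint, ContinuousLinearMap.adjoint_inner_right]

theorem CE_normsq {f : ℝ → ℂ} (hf : Continuous f) (v : H) :
    ‖CE_F D f v‖ ^ 2 = (inner ℂ (CE_F D (fun t => ((‖f t‖ ^ 2 : ℝ) : ℂ)) v) v : ℂ).re := by
  have : (fun t => ((‖f t‖ ^ 2 : ℝ) : ℂ)) = fun t => star (f t) * f t := by
    ext t
    simp only [Complex.star_def, Complex.conj_mul']; push_cast; rfl
  rw [this, CE_mul (by fun_prop) hf, mul_apply_eq_comp, CE_inner]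
  simp only [star_star]
  rw [inner_self_eq_norm_sq_to_K]
  norm_cast

theorem CE_pos (hD : IsSelfAdjoint D) {f : ℝ → ℝ} (hf : Continuous f)
    (h : ∀ t : ℝ, |t| ≤ ‖D‖ → 0 ≤ f t) (v : H) :
    0 ≤ (inner ℂ (CE_F D (fun t => (f t : ℂ)) v) v : ℂ).re := by
  have : CE_F D (fun t => (f t : ℂ)) =
      CE_F D (fun t => ((‖((Real.sqrt (f t) : ℝ) : ℂ)‖ ^ 2 : ℝ) : ℂ)) := by
    apply CE_congr hD
    intro t ht
    simp [Real.sq_sqrt (h t ht)]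
  rw [this, ← CE_normsq (by fun_prop)]
  positivity

/-- positivity on the kernel of `w(D)`. -/
theorem CE_posB (hD : IsSelfAdjoint D) {f w : ℝ → ℝ} (hf : Continuous f) (hw : Continuous w)
    (hw0 : ∀ t, 0 ≤ w t) (h : ∀ t : ℝ, |t| ≤ ‖D‖ → w t = 0 → 0 ≤ f t) (v : H)
    (hv : CE_F D (fun t => (w t : ℂ)) v = 0) :
    0 ≤ (inner ℂ (CE_F D (fun t => (f t : ℂ)) v) v : ℂ).re := by
  have key : ∀ δ : ℝ, 0 < δ → 0 ≤ (inner ℂ (CE_F D (fun t => (f t : ℂ)) v) v : ℂ).re + δ * ‖v‖ ^ 2 := by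
    intro δ hδ
    obtain ⟨C, hC⟩ : ∃ C : ℝ, ∀ t : ℝ, |t| ≤ ‖D‖ → 0 ≤ f t + δ + C * w t := by
      set X : Set ℝ := Metric.closedBall 0 ‖D‖ ∩ {t | f t + δ ≤ 0} with hX
      have hXc : IsCompact X := (isCompact_closedBall 0 ‖D‖).inter_right
        (isClosed_le (by fun_prop) continuous_const)
      have hpos : ∀ t ∈ X, 0 < w t := by
        rintro t ⟨ht1, ht2⟩
        have ht1' : |t| ≤ ‖D‖ := by simpa using ht1
        rcases (hw0 t).lt_or_eq with h1 | h1
        · exact h1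
        · have := h t ht1' h1.symm
          simp only [Set.mem_ofPred_eq] at ht2
          linarith
      obtain ⟨C, hC⟩ := hXc.exists_bound_of_continuousOn (f := fun t => (f t + δ) / w t)
        (ContinuousOn.div (by fun_prop) (by fun_prop) (fun t ht => (hpos t ht).ne'))
      refine ⟨max C 0, fun t ht => ?_⟩
      by_cases hft : f t + δ ≤ 0
      · have htX : t ∈ X := ⟨by simpa using ht, hft⟩
        have h1 := hC t htX
        have h2 := hpos t htX
        rw [Real.norm_eq_abs] at h1
        have h3 := (abs_le.mp h1).1
        rw [le_div_iff₀ h2] at h3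
        nlinarith [le_max_left C 0]
      · have := mul_nonneg (le_max_right C 0) (hw0 t)
        linarith
    have h1 := CE_pos hD (f := fun t => f t + δ + C * w t) (by fun_prop) hC v
    have h2 : CE_F D (fun t => ((f t + δ + C * w t : ℝ) : ℂ)) =
        CE_F D (fun t => (f t : ℂ)) + (δ : ℂ) • 1 + ((C : ℂ) • 1) * CE_F D (fun t => (w t : ℂ)) := by
      push_cast
      rw [CE_add (by fun_prop) (by fun_prop), CE_add (by fun_prop) (by fun_prop),
        CE_mul (by fun_prop) (by fun_prop), CE_const hD, CE_const hD]
    rw [h2] at h1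
    simp only [add_apply, mul_apply_eq_comp, hv, map_zero, add_zero,
      inner_add_left, smul_apply, one_apply_eq_self, inner_smul_left,
      Complex.add_re, Complex.conj_ofReal, Complex.re_ofReal_mul] at h1
    have h3 : (inner ℂ v v : ℂ).re = ‖v‖ ^ 2 := by
      rw [inner_self_eq_norm_sq_to_K]; norm_cast
    rwa [h3] at h1
  by_contra hneg
  push Not at hneg
  set q := (inner ℂ (CE_F D (fun t => (f t : ℂ)) v) v : ℂ).re with hq
  have := key (-q / (2 * (‖v‖ ^ 2 + 1))) (by apply div_pos <;> [linarith; positivity])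
  have h4 : -q / (2 * (‖v‖ ^ 2 + 1)) * ‖v‖ ^ 2 ≤ -q / 2 := by
    rw [div_mul_eq_mul_div, div_le_div_iff₀ (by positivity) (by positivity)]
    nlinarith [sq_nonneg ‖v‖]
  linarith

/-- norm bound on the kernel of `w(D)`. -/
theorem CE_bound (hD : IsSelfAdjoint D) {f : ℝ → ℂ} {w : ℝ → ℝ} (hf : Continuous f)
    (hw : Continuous w)
    (hw0 : ∀ t, 0 ≤ w t) (M : ℝ) (hM : 0 ≤ M)
    (h : ∀ t : ℝ, |t| ≤ ‖D‖ → w t = 0 → ‖f t‖ ≤ M) (v : H)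
    (hv : CE_F D (fun t => (w t : ℂ)) v = 0) :
    ‖CE_F D f v‖ ≤ M * ‖v‖ := by
  have h1 := CE_posB hD (f := fun t => M ^ 2 - ‖f t‖ ^ 2) (w := w) (by fun_prop) hw hw0
    (fun t ht hwt => by have := h t ht hwt; have := norm_nonneg (f t); nlinarith) v hv
  have h2 : CE_F D (fun t => ((M ^ 2 - ‖f t‖ ^ 2 : ℝ) : ℂ)) =
      ((M ^ 2 : ℝ) : ℂ) • 1 - CE_F D (fun t => ((‖f t‖ ^ 2 : ℝ) : ℂ)) := by
    rw [← CE_const hD, ← CE_sub (by fun_prop) (by fun_prop)]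
    congr 1; ext t; push_cast; rfl
  rw [h2] at h1
  have h3 : (inner ℂ v v : ℂ).re = ‖v‖ ^ 2 := by
    rw [inner_self_eq_norm_sq_to_K]; norm_cast
  simp only [sub_apply, inner_sub_left, smul_apply,
    one_apply_eq_self, inner_smul_left, Complex.sub_re, Complex.conj_ofReal,
    Complex.re_ofReal_mul, ← CE_normsq hf, h3] at h1
  refine (pow_le_pow_iff_left₀ (norm_nonneg _) (by positivity) two_ne_zero).mp ?_
  rw [mul_pow]; linarith

/-- vanishing on the kernel of `w(D)`. -/
theorem CE_vanish (hD : IsSelfAdjoint D) {f : ℝ → ℂ} {w : ℝ → ℝ} (hf : Continuous f)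
    (hw : Continuous w)
    (hw0 : ∀ t, 0 ≤ w t)
    (h : ∀ t : ℝ, |t| ≤ ‖D‖ → w t = 0 → f t = 0) (v : H)
    (hv : CE_F D (fun t => (w t : ℂ)) v = 0) :
    CE_F D f v = 0 := by
  have := CE_bound hD hf hw hw0 0 le_rfl (fun t ht hwt => by simp [h t ht hwt]) v hv
  simpa using this

end

section
variable {H : Type*} [NormedAddCommGroup H] [InnerProductSpace ℂ H] [CompleteSpace H]

noncomputable def CE_K (D : H →L[ℂ] H) (c : ℝ) : Submodule ℂ H :=
  LinearMap.ker (CE_F D (fun t => ((max (t - c) 0 : ℝ) : ℂ)) : H →ₗ[ℂ] H)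

theorem CE_mem_K {D : H →L[ℂ] H} {c : ℝ} {v : H} :
    v ∈ CE_K D c ↔ CE_F D (fun t => ((max (t - c) 0 : ℝ) : ℂ)) v = 0 := by
  simp [CE_K]

instance CE_K_complete (D : H →L[ℂ] H) (c : ℝ) : CompleteSpace (CE_K D c) := by
  apply IsClosed.completeSpace_coe (hs := ?_)
  exact (CE_F D (fun t => ((max (t - c) 0 : ℝ) : ℂ))).isClosed_ker

theorem CE_K_inv {D : H →L[ℂ] H} {c : ℝ} {v : H} (f : ℝ → ℂ) (hv : v ∈ CE_K D c) :
    CE_F D f v ∈ CE_K D c := by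
  rw [CE_mem_K] at hv ⊢
  rw [← mul_apply_eq_comp, CE_comm, mul_apply_eq_comp, hv, map_zero]

theorem CE_K_perp {D : H →L[ℂ] H} {c : ℝ} {v : H} (f : ℝ → ℂ) (hv : v ∈ (CE_K D c)ᗮ) :
    CE_F D f v ∈ (CE_K D c)ᗮ := by
  rw [Submodule.mem_orthogonal'] at hv ⊢
  intro u hu
  rw [CE_inner]
  exact hv _ (CE_K_inv _ hu)

theorem CE_K_mono {D : H →L[ℂ] H} (hD : IsSelfAdjoint D) {c d : ℝ} (h : c ≤ d) :
    CE_K D c ≤ CE_K D d := by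
  intro v hv
  rw [CE_mem_K] at hv ⊢
  refine CE_vanish hD (w := fun t => max (t - c) 0) (by fun_prop) (by fun_prop)
    (fun t => le_max_right _ _) ?_ v hv
  intro t _ ht
  have : t - c ≤ 0 := by rw [← ht]; exact le_max_left _ _
  rw [max_eq_right (by linarith)]; simp

noncomputable def CE_P (D : H →L[ℂ] H) (c : ℝ) : H →L[ℂ] H := (CE_K D c).starProjection

theorem CE_P_comm (D : H →L[ℂ] H) (c : ℝ) (f : ℝ → ℂ) :
    CE_P D c * CE_F D f = CE_F D f * CE_P D c := by
  ext v
  rw [mul_apply_eq_comp, mul_apply_eq_comp]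
  have h1 : CE_F D f v = CE_F D f (CE_P D c v) + CE_F D f (v - CE_P D c v) := by
    rw [← map_add]; congr 1; abel
  have h2 : CE_P D c (CE_F D f (CE_P D c v)) = CE_F D f (CE_P D c v) :=
    Submodule.starProjection_eq_self_iff.mpr
      (CE_K_inv f (Submodule.starProjection_apply_mem _ v))
  have h3 : CE_P D c (CE_F D f (v - CE_P D c v)) = 0 :=
    (Submodule.starProjection_apply_eq_zero_iff _).mpr
      (CE_K_perp f (Submodule.sub_starProjection_mem_orthogonal v))
  rw [h1, map_add, h2, h3, add_zero]

theorem CE_P_sym (D : H →L[ℂ] H) (c : ℝ) (u v : H) :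
    inner ℂ (CE_P D c u) v = inner ℂ u (CE_P D c v) :=
  Submodule.inner_starProjection_left_eq_right _ u v

theorem CE_P_mul {D : H →L[ℂ] H} (hD : IsSelfAdjoint D) {c d : ℝ} (h : c ≤ d) :
    CE_P D d * CE_P D c = CE_P D c := by
  ext v
  exact Submodule.starProjection_eq_self_iff.mpr
    (CE_K_mono hD h (Submodule.starProjection_apply_mem _ v))

theorem CE_P_mul' {D : H →L[ℂ] H} (hD : IsSelfAdjoint D) {c d : ℝ} (h : c ≤ d) :
    CE_P D c * CE_P D d = CE_P D c := by
  ext v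
  apply ext_inner_right ℂ
  intro u
  rw [mul_apply_eq_comp, CE_P_sym, CE_P_sym, ← mul_apply_eq_comp, CE_P_mul hD h, CE_P_sym]

theorem CE_exists_proj {D : H →L[ℂ] H} (hD : IsSelfAdjoint D) :
    ∃ (N : ℕ) (e : ℤ → (H →L[ℂ] H)),
      (∀ j u v, inner ℂ (e j u) v = inner ℂ u (e j v)) ∧
      (∀ j, e j * e j = e j) ∧
      (∀ j k, j ≠ k → e j * e k = 0) ∧
      (∑ j ∈ Finset.Ico (-(N : ℤ)) N, e j = 1) ∧
      (∀ j f, e j * CE_F D f = CE_F D f * e j) ∧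
      (∀ (j : ℤ) v, CE_F D (fun t => ((max ((j : ℝ) - t) 0 + max (t - (j + 1)) 0 : ℝ) : ℂ)) (e j v) = 0) := by
  obtain ⟨N, hN⟩ := exists_nat_gt ‖D‖
  have hcross : ∀ j k : ℤ, j < k →
      (CE_P D (j + 1) - CE_P D j) * (CE_P D (k + 1) - CE_P D k) = 0 ∧ 
      (CE_P D (k + 1) - CE_P D k) * (CE_P D (j + 1) - CE_P D j) = 0 := by
    intro j k hjk
    have hjk' : (j : ℝ) + 1 ≤ k := by exact_mod_cast hjk
    constructor
    · rw [sub_mul, mul_sub, mul_sub, CE_P_mul' hD (by linarith), CE_P_mul' hD (by linarith),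
        CE_P_mul' hD (by linarith), CE_P_mul' hD (by linarith)]; simp
    · rw [sub_mul, mul_sub, mul_sub, CE_P_mul hD (by linarith), CE_P_mul hD (by linarith),
        CE_P_mul hD (by linarith), CE_P_mul hD (by linarith)]; simp
  refine ⟨N, fun j => CE_P D (j + 1) - CE_P D j, ?_, ?_, ?_, ?_, ?_, ?_⟩
  · intro j u v
    simp only [sub_apply, inner_sub_left, inner_sub_right, CE_P_sym]
  · intro j
    rw [sub_mul, mul_sub, mul_sub, CE_P_mul hD (by linarith), CE_P_mul hD (by linarith),
        CE_P_mul' hD (by linarith), CE_P_mul hD (by linarith)]; simp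
  · intro j k hjk
    rcases lt_or_gt_of_ne hjk with h | h
    · exact (hcross j k h).1
    · exact (hcross k j h).2
  · have htel : ∀ M : ℕ, ∑ j ∈ Finset.Ico (-(N : ℤ)) (-(N : ℤ) + M), (CE_P D (j + 1) - CE_P D j)
        = CE_P D (-(N : ℝ) + M) - CE_P D (-(N : ℝ)) := by
      intro M
      induction M with
      | zero => simp
      | succ M ih =>
        have : Finset.Ico (-(N : ℤ)) (-(N : ℤ) + (M + 1 : ℕ)) =
            insert (-(N : ℤ) + M) (Finset.Ico (-(N : ℤ)) (-(N : ℤ) + M)) := by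
          ext x; simp only [Finset.mem_Ico, Finset.mem_insert]; push_cast; omega
        rw [this, Finset.sum_insert (by simp), ih]
        push_cast
        rw [add_assoc]; abel
    have h1 := htel (2 * N)
    have h2 : -(N : ℤ) + ((2 * N : ℕ) : ℤ) = N := by push_cast; ring
    have h3 : -(N : ℝ) + ((2 * N : ℕ) : ℝ) = N := by push_cast; ring
    rw [h2, h3] at h1
    rw [h1]
    have h4 : CE_P D N = 1 := by
      ext v
      refine Submodule.starProjection_eq_self_iff.mpr ?_
      rw [CE_mem_K]
      have : CE_F D (fun t => ((max (t - (N : ℝ)) 0 : ℝ) : ℂ)) = CE_F D (fun _ => 0) := by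
        apply CE_congr hD
        intro t ht
        rw [max_eq_right (by linarith [le_abs_self t])]; simp
      rw [this, CE_const hD]; simp
    have h5 : CE_P D (-(N : ℝ)) = 0 := by
      ext v
      have h6 : CE_P D (-(N : ℝ)) v ∈ CE_K D (-(N : ℝ)) := Submodule.starProjection_apply_mem _ v
      rw [CE_mem_K] at h6
      have := CE_vanish hD (f := fun _ => 1) (w := fun t => max (t - (-(N : ℝ))) 0)
        (by fun_prop) (by fun_prop) (fun t => le_max_right _ _) (by
          intro t ht hw
          have : t - (-(N : ℝ)) ≤ 0 := by rw [← hw]; exact le_max_left _ _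
          linarith [neg_abs_le t]) _ h6
      rw [CE_const hD] at this
      simpa using this
    rw [h4, h5, sub_zero]
  · intro j f
    rw [sub_mul, mul_sub, CE_P_comm, CE_P_comm]
  · intro j v
    set x := (CE_P D (j + 1) - CE_P D j) v with hx
    have hx1 : x ∈ CE_K D (j + 1) := by
      rw [hx, sub_apply]
      exact Submodule.sub_mem _ (Submodule.starProjection_apply_mem _ v)
        (CE_K_mono hD (by linarith) (Submodule.starProjection_apply_mem _ v))
    have hx2 : x ∈ (CE_K D j)ᗮ := by
      apply (Submodule.starProjection_apply_eq_zero_iff _).mp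
      change CE_P D j x = 0
      rw [hx, ← mul_apply_eq_comp, mul_sub, CE_P_mul' hD (by linarith), CE_P_mul hD le_rfl]
      simp
    have hx3 : CE_F D (fun t => ((max ((j : ℝ) - t) 0 : ℝ) : ℂ)) x = 0 := by
      have ha : CE_F D (fun t => ((max ((j : ℝ) - t) 0 : ℝ) : ℂ)) x ∈ CE_K D j := by
        rw [CE_mem_K, ← mul_apply_eq_comp, ← CE_mul (by fun_prop) (by fun_prop)]
        have : (fun t : ℝ => ((max (t - (j : ℝ)) 0 : ℝ) : ℂ) * ((max ((j : ℝ) - t) 0 : ℝ) : ℂ)) = fun _ => 0 := by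
          ext t
          rcases le_total t j with h | h
          · rw [max_eq_right (by linarith)]; simp
          · rw [max_eq_right (a := (j : ℝ) - t) (by linarith)]; simp
        rw [this, CE_const hD]; simp
      have hb := CE_K_perp (fun t => ((max ((j : ℝ) - t) 0 : ℝ) : ℂ)) hx2
      rw [Submodule.mem_orthogonal] at hb
      exact inner_self_eq_zero.mp (hb _ ha)
    push_cast
    rw [CE_mem_K] at hx1
    have := CE_add (D := D) (f := fun t => ((max ((j : ℝ) - t) 0 : ℝ) : ℂ))
      (g := fun t => ((max (t - ((j : ℝ) + 1)) 0 : ℝ) : ℂ)) (by fun_prop) (by fun_prop)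
    rw [this, add_apply]
    rw [hx1, hx3, add_zero]
end

theorem CE_sum_inj (p : ℝ) (hp : 1 < p) (S : Finset ℤ) (φ : ℤ → ℕ)
    (hφ : Set.InjOn φ S) : ∑ j ∈ S, ((φ j : ℝ) + 1) ^ (-p) ≤ p / (p - 1) := by
  rw [← Finset.sum_image (f := fun m : ℕ => ((m : ℝ) + 1) ^ (-p)) (g := φ) hφ]
  obtain ⟨M, hM⟩ := Finset.exists_nat_subset_range (S.image φ)
  exact (Finset.sum_le_sum_of_subset_of_nonneg hM (fun _ _ _ => by positivity)).trans
    (CE_sum_rpow p hp M)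

theorem CE_col_sum (p : ℝ) (hp : 1 < p) (J : Finset ℤ) (k : ℤ) :
    ∑ j ∈ J, (if j = k then 0 else |(j : ℝ) - k| ^ (-p)) ≤ 2 * (p / (p - 1)) := by
  have h1 : ∀ j ∈ J, (if j = k then 0 else |(j : ℝ) - k| ^ (-p)) =
      (if k < j then (((j - k - 1).toNat : ℝ) + 1) ^ (-p) else 0) +
      (if j < k then (((k - j - 1).toNat : ℝ) + 1) ^ (-p) else 0) := by
    intro j _
    rcases lt_trichotomy j k with h | h | h
    · rw [if_neg h.ne, if_neg (by omega), if_pos h, zero_add]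
      have h2 : ((k - j - 1).toNat : ℤ) = k - j - 1 := Int.toNat_of_nonneg (by omega)
      have h3 : (((k - j - 1).toNat : ℤ) : ℝ) = k - j - 1 := by rw [h2]; push_cast; ring
      rw [Int.cast_natCast] at h3
      have h4 : (j : ℝ) < k := by exact_mod_cast h
      rw [h3, abs_of_neg (by linarith)]; congr 1; ring
    · simp [h]
    · rw [if_neg h.ne', if_neg (show ¬ j < k by omega), if_pos h, add_zero]
      have h2 : ((j - k - 1).toNat : ℤ) = j - k - 1 := Int.toNat_of_nonneg (by omega)
      have h3 : (((j - k - 1).toNat : ℤ) : ℝ) = j - k - 1 := by rw [h2]; push_cast; ring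
      rw [Int.cast_natCast] at h3
      have h4 : (k : ℝ) < j := by exact_mod_cast h
      rw [h3, abs_of_pos (by linarith)]; congr 1; ring
  rw [Finset.sum_congr rfl h1, Finset.sum_add_distrib, ← Finset.sum_filter, ← Finset.sum_filter,
    two_mul]
  apply add_le_add
  · apply CE_sum_inj p hp _ (fun j => (j - k - 1).toNat)
    intro a ha b hb hab
    simp only [Finset.coe_filter, Set.mem_ofPred_eq] at ha hb
    simp only at hab
    omega
  · apply CE_sum_inj p hp _ (fun j => (k - j - 1).toNat)
    intro a ha b hb hab
    simp only [Finset.coe_filter, Set.mem_ofPred_eq] at ha hb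
    simp only at hab
    omega

theorem CE_binom {R : Type*} [Ring R] (T y : R) (n : ℕ) :
    y * T ^ n = ∑ i ∈ Finset.range (n + 1),
      (((-1) ^ i * (n.choose i : ℤ)) : ℤ) • (T ^ (n - i) * (fun z => T * z - z * T)^[i] y) := by
  set L : Module.End ℤ R := LinearMap.mulLeft ℤ T
  set Rt : Module.End ℤ R := LinearMap.mulRight ℤ T
  have hLR : Commute L Rt := by
    ext z; simp [L, Rt, mul_assoc]
  set ad : Module.End ℤ R := L - Rt with had
  have hc : Commute (-ad) L := by
    rw [had, neg_sub]; exact (hLR.symm.sub_left (Commute.refl L))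
  have hR : Rt = -ad + L := by rw [had]; abel
  have hRp : ∀ m : ℕ, (Rt ^ m) y = y * T ^ m := by
    intro m; simp [Rt, LinearMap.pow_mulRight]
  have hLp : ∀ (m : ℕ) z, (L ^ m) z = T ^ m * z := by
    intro m z; simp [L, LinearMap.pow_mulLeft]
  have hadp : ∀ i : ℕ, (ad ^ i) y = (fun z => T * z - z * T)^[i] y := by
    intro i
    rw [Module.End.pow_apply]
    rfl
  rw [← hRp, hR, hc.add_pow, LinearMap.sum_apply]
  apply Finset.sum_congr rfl
  intro i _
  rw [(hc.pow_pow i (n - i)).eq, neg_pow, ← hadp, ← hLp]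
  have : (((-1 : Module.End ℤ R)) ^ i * ad ^ i) = ((-1 : ℤ) ^ i) • ad ^ i := by
    rw [zsmul_eq_mul]; push_cast; rfl
  rw [this, mul_smul_comm]
  have h2 : ((n.choose i : ℕ) : Module.End ℤ R) y = (n.choose i : ℤ) • y := by
    simp
  rw [Module.End.mul_apply, h2, map_zsmul, LinearMap.smul_apply, smul_smul, mul_comm,
    Module.End.mul_apply]

section
variable {H : Type*} [NormedAddCommGroup H] [InnerProductSpace ℂ H] 

theorem CE_pyth (J : Finset ℤ) (x : ℤ → H)
    (h : ∀ j ∈ J, ∀ k ∈ J, j ≠ k → inner ℂ (x j) (x k) = 0) :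
    ‖∑ j ∈ J, x j‖ ^ 2 = ∑ j ∈ J, ‖x j‖ ^ 2 := by
  have h1 : (inner ℂ (∑ j ∈ J, x j) (∑ j ∈ J, x j) : ℂ) = ∑ j ∈ J, inner ℂ (x j) (x j) := by
    rw [sum_inner]
    apply Finset.sum_congr rfl
    intro j hj
    rw [inner_sum]
    apply Finset.sum_eq_single_of_mem j hj
    intro k hk hkj
    exact h j hj k hk hkj.symm
  simp only [inner_self_eq_norm_sq_to_K] at h1
  exact_mod_cast h1

variable [CompleteSpace H]

theorem CE_row {D : H →L[ℂ] H} (hD : IsSelfAdjoint D) (J : Finset ℤ) (j : ℤ) (x : ℤ → H) (v : H)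
    (hx : ∀ k ∈ J, ∀ l ∈ J, k ≠ l → inner ℂ (x k) (x l) = 0)
    (hv : CE_F D (fun t => ((max ((j : ℝ) - t) 0 + max (t - (j + 1)) 0 : ℝ) : ℂ)) v = 0)
    (z : H →L[ℂ] H) (m : ℕ) (b : ℤ → ℝ) (hb1 : ∀ k, j < k → b k = j) 
    (hb2 : ∀ k, ¬ j < k → b k = j + 1) :
    ‖∑ k ∈ J, inner ℂ (z (x k)) (CE_F D (fun t => ((t - b k : ℝ) : ℂ) ^ m) v)‖ ≤
      ‖z‖ * (Real.sqrt (∑ k ∈ J, ‖x k‖ ^ 2) * ‖v‖) := by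
  rcases Nat.eq_zero_or_pos m with hm | hm
  · subst hm
    have : CE_F D (fun _ => 1) v = v := by rw [CE_const hD]; simp
    simp only [pow_zero, this]
    rw [← sum_inner, ← map_sum, ← CE_pyth J x hx, Real.sqrt_sq (norm_nonneg _)]
    calc _ ≤ ‖z (∑ k ∈ J, x k)‖ * ‖v‖ := norm_inner_le_norm _ _
      _ ≤ (‖z‖ * ‖∑ k ∈ J, x k‖) * ‖v‖ := by gcongr; exact z.le_opNorm _
      _ = _ := by ring
  · set a1 := CE_F D (fun t => ((t - j : ℝ) : ℂ) ^ m) v with ha1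
    set a2 := CE_F D (fun t => ((t - (j + 1) : ℝ) : ℂ) ^ m) v with ha2
    set X1 := ∑ k ∈ J with j < k, x k with hX1
    set X2 := ∑ k ∈ J with ¬ j < k, x k with hX2
    have hsum : ∑ k ∈ J, inner ℂ (z (x k)) (CE_F D (fun t => ((t - b k : ℝ) : ℂ) ^ m) v) =
        inner ℂ (z X1) a1 + inner ℂ (z X2) a2 := by
      rw [← Finset.sum_filter_add_sum_filter_not J (fun k => j < k), hX1, hX2, map_sum, map_sum,
        sum_inner, sum_inner]
      congr 1
      · apply Finset.sum_congr rfl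
        intro k hk
        rw [hb1 k (Finset.mem_filter.mp hk).2]
      · apply Finset.sum_congr rfl
        intro k hk
        rw [hb2 k (Finset.mem_filter.mp hk).2]
    have hX : ‖X1‖ ^ 2 + ‖X2‖ ^ 2 = ∑ k ∈ J, ‖x k‖ ^ 2 := by
      rw [hX1, hX2, CE_pyth _ x, CE_pyth _ x, Finset.sum_filter_add_sum_filter_not]
      · intro k hk l hl
        exact hx k (Finset.mem_filter.mp hk).1 l (Finset.mem_filter.mp hl).1
      · intro k hk l hl
        exact hx k (Finset.mem_filter.mp hk).1 l (Finset.mem_filter.mp hl).1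
    have ha : ‖a1‖ ^ 2 + ‖a2‖ ^ 2 ≤ ‖v‖ ^ 2 := by
      have h1 := CE_posB hD
        (f := fun t => 1 - (‖((t - j : ℝ) : ℂ) ^ m‖ ^ 2 + ‖((t - (j + 1) : ℝ) : ℂ) ^ m‖ ^ 2))
        (w := fun t => max ((j : ℝ) - t) 0 + max (t - (j + 1)) 0) (by fun_prop) (by fun_prop)
        (fun t => add_nonneg (le_max_right _ _) (le_max_right _ _)) (by
          intro t _ ht
          have e1 := le_max_left ((j : ℝ) - t) 0
          have e2 := le_max_left (t - ((j : ℝ) + 1)) 0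
          have e3 := le_max_right ((j : ℝ) - t) 0
          have e4 := le_max_right (t - ((j : ℝ) + 1)) 0
          have f1 : 0 ≤ t - j := by linarith
          have f2 : t - j ≤ 1 := by linarith
          have g1 : ‖((t - j : ℝ) : ℂ) ^ m‖ ≤ t - j := by
            rw [norm_pow, Complex.norm_real, Real.norm_of_nonneg f1]
            exact pow_le_of_le_one f1 f2 hm.ne'
          have g2 : ‖((t - (j + 1) : ℝ) : ℂ) ^ m‖ ≤ 1 - (t - j) := by
            rw [norm_pow, Complex.norm_real, Real.norm_of_nonpos (by linarith)]
            refine (pow_le_of_le_one (by linarith) (by linarith) hm.ne').trans (by linarith)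
          have := norm_nonneg (((t - j : ℝ) : ℂ) ^ m)
          have := norm_nonneg (((t - (j + 1) : ℝ) : ℂ) ^ m)
          nlinarith) v hv
      have h2 : CE_F D (fun t => ((1 - (‖((t - j : ℝ) : ℂ) ^ m‖ ^ 2 + ‖((t - (j + 1) : ℝ) : ℂ) ^ m‖ ^ 2) : ℝ) : ℂ)) =
          CE_F D (fun _ => 1) - (CE_F D (fun t => ((‖((t - j : ℝ) : ℂ) ^ m‖ ^ 2 : ℝ) : ℂ)) + 
            CE_F D (fun t => ((‖((t - (j + 1) : ℝ) : ℂ) ^ m‖ ^ 2 : ℝ) : ℂ))) := by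
        rw [← CE_add (by fun_prop) (by fun_prop), ← CE_sub (by fun_prop) (by fun_prop)]
        congr 1; ext t; push_cast; rfl
      have h3 : (inner ℂ v v : ℂ).re = ‖v‖ ^ 2 := by
        rw [inner_self_eq_norm_sq_to_K]; norm_cast
      rw [h2, CE_const hD, one_smul, sub_apply, add_apply, one_apply_eq_self, inner_sub_left,
        inner_add_left, Complex.sub_re, Complex.add_re, ← CE_normsq (by fun_prop),
        ← CE_normsq (by fun_prop), h3] at h1
      linarith
    rw [hsum]
    have hcs : ‖X1‖ * ‖a1‖ + ‖X2‖ * ‖a2‖ ≤ Real.sqrt (∑ k ∈ J, ‖x k‖ ^ 2) * ‖v‖ := by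
      rw [← hX, ← Real.sqrt_sq (norm_nonneg v), ← Real.sqrt_mul (by positivity)]
      apply Real.le_sqrt_of_sq_le
      calc _ ≤ (‖X1‖ ^ 2 + ‖X2‖ ^ 2) * (‖a1‖ ^ 2 + ‖a2‖ ^ 2) := by
            nlinarith [sq_nonneg (‖X1‖ * ‖a2‖ - ‖X2‖ * ‖a1‖)]
        _ ≤ _ := by gcongr
    calc _ ≤ ‖(inner ℂ (z X1) a1 : ℂ)‖ + ‖(inner ℂ (z X2) a2 : ℂ)‖ := norm_add_le _ _
      _ ≤ ‖z X1‖ * ‖a1‖ + ‖z X2‖ * ‖a2‖ := add_le_add (norm_inner_le_norm _ _) (norm_inner_le_norm _ _)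
      _ ≤ (‖z‖ * ‖X1‖) * ‖a1‖ + (‖z‖ * ‖X2‖) * ‖a2‖ := by
          gcongr <;> exact z.le_opNorm _
      _ = ‖z‖ * (‖X1‖ * ‖a1‖ + ‖X2‖ * ‖a2‖) := by ring
      _ ≤ _ := by gcongr
end

section
variable {H : Type*} [NormedAddCommGroup H] [InnerProductSpace ℂ H] [CompleteSpace H]

theorem CE_w_zero {k t : ℝ} (ht : max (k - t) 0 + max (t - (k + 1)) 0 = 0) : k ≤ t ∧ t ≤ k + 1 := by
  have e1 := le_max_left (k - t) 0
  have e2 := le_max_left (t - (k + 1)) 0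
  have e3 := le_max_right (k - t) 0
  have e4 := le_max_right (t - (k + 1)) 0
  constructor <;> linarith

theorem CE_x {D : H →L[ℂ] H} (hD : IsSelfAdjoint D) (j k : ℤ) (v : H)
    (hv : CE_F D (fun t => ((max ((k : ℝ) - t) 0 + max (t - (k + 1)) 0 : ℝ) : ℂ)) v = 0)
    (n : ℕ) (α C : ℝ) (c : ℂ) (hc0 : j = k → c = 0)
    (hc : j ≠ k → ‖c‖ ≤ C * |(j : ℝ) - k| ^ α) :
    ∃ f : ℝ → ℂ,
      CE_F D (fun t => ((t - (if j < k then (j : ℝ) else j + 1) : ℝ) : ℂ) ^ n) (CE_F D f v) = c • v ∧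
      ‖CE_F D f v‖ ≤ (C * if j = k then 0 else |(j : ℝ) - k| ^ (α - n)) * ‖v‖ := by
  by_cases hjk : j = k
  · refine ⟨fun _ => 0, ?_, ?_⟩
    · rw [CE_const hD, hc0 hjk]; simp
    · rw [CE_const hD]; simp [hjk]
  · set b : ℝ := if j < k then (j : ℝ) else j + 1 with hb
    have hpos : 0 < |(j : ℝ) - k| := by
      rw [abs_pos, sub_ne_zero]; exact_mod_cast hjk
    have hlow : ∀ s : ℝ, (k : ℝ) ≤ s → s ≤ k + 1 → |(j : ℝ) - k| ≤ |s - b| := by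
      intro s h1 h2
      rcases lt_or_gt_of_ne hjk with h | h
      · have h' : (j : ℝ) < k := by exact_mod_cast h
        rw [hb, if_pos h, abs_of_neg (by linarith), abs_of_nonneg (by linarith)]; linarith
      · have h' : (k : ℝ) + 1 ≤ j := by exact_mod_cast h
        rw [hb, if_neg (by omega), abs_of_pos (by linarith), abs_of_nonpos (by linarith)]; linarith
    set cl : ℝ → ℝ := fun t => max (k : ℝ) (min t (k + 1)) with hcl
    have hcl1 : ∀ t, |(j : ℝ) - k| ≤ |cl t - b| := fun t =>
      hlow _ (le_max_left _ _) (max_le (by linarith) (min_le_right _ _))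
    have hne : ∀ t, ((cl t - b : ℝ) : ℂ) ^ n ≠ 0 := by
      intro t
      apply pow_ne_zero
      rw [Complex.ofReal_ne_zero, ← abs_pos]
      exact hpos.trans_le (hcl1 t)
    have hclc : Continuous cl := by fun_prop
    have hfc : Continuous (fun t => c * (((cl t - b : ℝ) : ℂ) ^ n)⁻¹) :=
      continuous_const.mul (Continuous.inv₀ (by fun_prop) hne)
    refine ⟨fun t => c * (((cl t - b : ℝ) : ℂ) ^ n)⁻¹, ?_, ?_⟩
    · rw [← mul_apply_eq_comp, ← CE_mul (by fun_prop) hfc]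
      have h1 := CE_vanish hD 
        (f := fun t => ((t - b : ℝ) : ℂ) ^ n * (c * (((cl t - b : ℝ) : ℂ) ^ n)⁻¹) - c)
        (w := fun t => max ((k : ℝ) - t) 0 + max (t - (k + 1)) 0)
        (((by fun_prop : Continuous fun t : ℝ => ((t - b : ℝ) : ℂ) ^ n).mul hfc).sub continuous_const)
        (by fun_prop)
        (fun t => add_nonneg (le_max_right _ _) (le_max_right _ _)) (by
          intro t _ ht
          obtain ⟨h1, h2⟩ := CE_w_zero ht
          have h3 : cl t = t := by
            rw [hcl]; simp only; rw [min_eq_left h2, max_eq_right h1]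
          have h4 := hne t
          rw [h3] at h4 ⊢
          field_simp
          ring) v hv
      have h2 := CE_sub (D := D)
        (f := fun t => ((t - b : ℝ) : ℂ) ^ n * (c * (((cl t - b : ℝ) : ℂ) ^ n)⁻¹)) (g := fun _ => c)
        ((by fun_prop : Continuous fun t : ℝ => ((t - b : ℝ) : ℂ) ^ n).mul hfc) continuous_const
      rw [h2, CE_const hD, sub_apply, sub_eq_zero] at h1
      rw [h1]; simp
    · rw [if_neg hjk]
      have hC : 0 ≤ C := by
        have h1 := (norm_nonneg c).trans (hc hjk)
        have h2 : 0 < |(j : ℝ) - k| ^ α := by positivity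
        exact nonneg_of_mul_nonneg_left h1 h2
      refine CE_bound hD (w := fun t => max ((k : ℝ) - t) 0 + max (t - (k + 1)) 0) hfc (by fun_prop)
        (fun t => add_nonneg (le_max_right _ _) (le_max_right _ _)) _ (by positivity) ?_ v hv
      intro t _ _
      rw [norm_mul, norm_inv, norm_pow, Complex.norm_real, Real.norm_eq_abs, Real.rpow_sub hpos,
        Real.rpow_natCast, ← mul_div_assoc, ← div_eq_mul_inv]
      exact div_le_div₀ (by positivity) (hc hjk) (by positivity)
        (pow_le_pow_left₀ (abs_nonneg _) (hcl1 t) n)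

theorem CE_discrete {D : H →L[ℂ] H} (hD : IsSelfAdjoint D) (J : Finset ℤ) (e : ℤ → (H →L[ℂ] H))
    (he1 : ∀ j u v, inner ℂ (e j u) v = inner ℂ u (e j v))
    (he3 : ∀ j k, j ≠ k → e j * e k = 0)
    (he4 : ∑ j ∈ J, e j = 1)
    (he5 : ∀ j f, e j * CE_F D f = CE_F D f * e j)
    (he6 : ∀ (j : ℤ) v, CE_F D (fun t => ((max ((j : ℝ) - t) 0 + max (t - (j + 1)) 0 : ℝ) : ℂ)) (e j v) = 0)
    (α C : ℝ) (hC : 0 ≤ C) (g : ℤ → ℂ)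
    (hg : ∀ j k : ℤ, j ≠ k → ‖g j - g k‖ ≤ C * |(j : ℝ) - k| ^ α)
    (n : ℕ) (hn : (n : ℝ) > α + 1 / 2) (y : H →L[ℂ] H) :
    ‖(∑ j ∈ J, g j • e j) * y - y * (∑ j ∈ J, g j • e j)‖ ≤
      2 * C * (Real.sqrt ((n - α) / (2 * n - 2 * α - 1)) *
          ∑ k ∈ Finset.range (n + 1),
            (n.choose k : ℝ) * ‖(fun z => D * z - z * D)^[k] y‖) := by
  set S := ∑ k ∈ Finset.range (n + 1),
            (n.choose k : ℝ) * ‖(fun z => D * z - z * D)^[k] y‖ with hS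
  set q := Real.sqrt ((n - α) / (2 * n - 2 * α - 1)) with hq
  have hS0 : 0 ≤ S := Finset.sum_nonneg (fun _ _ => by positivity)
  have horth : ∀ j k : ℤ, j ≠ k → ∀ u v : H, inner ℂ (e j u) (e k v) = 0 := by
    intro j k hjk u v
    rw [he1, ← mul_apply_eq_comp, he3 j k hjk]; simp
  have hdec : ∀ v : H, ∑ j ∈ J, e j v = v := by
    intro v
    have := congrArg (fun T : H →L[ℂ] H => T v) he4
    simpa using this
  have hnorm : ∀ v : H, ∑ j ∈ J, ‖e j v‖ ^ 2 = ‖v‖ ^ 2 := by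
    intro v
    rw [← CE_pyth J (fun j => e j v) (fun j _ k _ hjk => horth j k hjk v v), hdec]
  set T := (∑ j ∈ J, g j • e j) * y - y * (∑ j ∈ J, g j • e j) with hT
  suffices main : ∀ ξ η : H, ‖(inner ℂ (T ξ) η : ℂ)‖ ≤ S * ((2 * C * q * ‖ξ‖) * ‖η‖) by
    refine ContinuousLinearMap.opNorm_le_bound _ (by positivity) (fun ξ => ?_)
    have h1 := main ξ (T ξ)
    have h2 : ‖(inner ℂ (T ξ) (T ξ) : ℂ)‖ = ‖T ξ‖ * ‖T ξ‖ := by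
      rw [inner_self_eq_norm_sq_to_K, norm_pow]; simp [sq]
    rw [h2] at h1
    rcases (norm_nonneg (T ξ)).eq_or_lt with h0 | h0
    · rw [← h0]; positivity
    · refine le_of_mul_le_mul_right ?_ h0
      linarith
  intro ξ η
  set b : ℤ → ℤ → ℝ := fun j k => if j < k then (j : ℝ) else j + 1 with hb
  have hex : ∀ j k : ℤ, ∃ f : ℝ → ℂ,
      CE_F D (fun t => ((t - b j k : ℝ) : ℂ) ^ n) (CE_F D f (e k ξ)) = (g j - g k) • e k ξ ∧
      ‖CE_F D f (e k ξ)‖ ≤ (C * if j = k then 0 else |(j : ℝ) - k| ^ (α - n)) * ‖e k ξ‖ :=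
    fun j k => CE_x hD j k (e k ξ) (he6 k ξ) n α C (g j - g k) (fun h => by simp [h]) (hg j k)
  choose f hf1 hf2 using hex
  set x : ℤ → ℤ → H := fun j k => CE_F D (f j k) (e k ξ) with hx
  have hxe : ∀ j k, x j k = e k (CE_F D (f j k) ξ) := by
    intro j k
    rw [hx]
    simp only
    rw [← mul_apply_eq_comp, ← he5, mul_apply_eq_comp]
  have hxorth : ∀ j, ∀ k ∈ J, ∀ l ∈ J, k ≠ l → inner ℂ (x j k) (x j l) = 0 := by
    intro j k _ l _ hkl
    rw [hxe, hxe]; exact horth k l hkl _ _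
  -- expansion of the matrix element
  have hTexp : (inner ℂ (T ξ) η : ℂ) = ∑ j ∈ J, ∑ k ∈ J, inner ℂ (y ((g j - g k) • e k ξ)) (e j η) := by
    have hTξ : T ξ = ∑ j ∈ J, ∑ k ∈ J, e j (y ((g j - g k) • e k ξ)) := by
      have h1 : T ξ = ∑ j ∈ J, g j • e j (y ξ) - y (∑ k ∈ J, g k • e k ξ) := by
        rw [hT]; simp
      have h2 : ∀ j ∈ J, ∑ k ∈ J, e j (y ((g j - g k) • e k ξ)) =
          g j • e j (y ξ) - e j (y (∑ k ∈ J, g k • e k ξ)) := by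
        intro j _
        rw [← map_sum, ← map_sum]
        simp only [sub_smul, Finset.sum_sub_distrib]
        rw [← Finset.smul_sum, hdec, map_sub, map_sub, map_smul, map_smul]
      rw [h1, Finset.sum_congr rfl h2, Finset.sum_sub_distrib, hdec]
    rw [hTξ, sum_inner]
    refine Finset.sum_congr rfl (fun j _ => ?_)
    rw [sum_inner]
    exact Finset.sum_congr rfl (fun k _ => he1 _ _ _)
  have hcontb : ∀ (r : ℝ), Continuous (fun t : ℝ => ((t - r : ℝ) : ℂ)) := fun r => by fun_prop
  have hterm : ∀ j k, (inner ℂ (y ((g j - g k) • e k ξ)) (e j η) : ℂ) =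
      ∑ i ∈ Finset.range (n + 1), (((-1) ^ i * (n.choose i : ℤ) : ℤ) : ℂ) *
        inner ℂ (((fun z => D * z - z * D)^[i] y) (x j k))
          (CE_F D (fun t => ((t - b j k : ℝ) : ℂ) ^ (n - i)) (e j η)) := by
    intro j k
    set U := CE_F D (fun t : ℝ => ((t - b j k : ℝ) : ℂ)) with hU
    have hUD : U = D - ((b j k : ℝ) : ℂ) • 1 := by
      rw [← CE_const hD, ← CE_id hD, CE_id hD, hU]
      have := CE_sub (D := D) (f := fun t : ℝ => (t : ℂ)) (g := fun _ => ((b j k : ℝ) : ℂ))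
        (by fun_prop) (by fun_prop)
      rw [CE_id hD] at this
      rw [← this]; congr 1; ext t; push_cast; rfl
    have had : (fun z => U * z - z * U) = (fun z => D * z - z * D) := by
      funext z
      rw [hUD]; simp only [sub_mul, mul_sub, smul_mul_assoc, mul_smul_comm, one_mul, mul_one]; abel
    have h1 := CE_binom U y n
    rw [had] at h1
    rw [← hf1 j k, CE_pow hD (hcontb _), ← hU, ← mul_apply_eq_comp, h1, sum_apply, sum_inner]
    refine Finset.sum_congr rfl (fun i _ => ?_)
    rw [← Int.cast_smul_eq_zsmul ℂ, smul_apply, inner_smul_left, mul_apply_eq_comp]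
    congr 1
    · simp
    · rw [← CE_pow hD (hcontb _), CE_inner]
      congr 3
      ext t
      rw [star_pow]; simp
  -- size of the vectors
  have hxsum : ∑ j ∈ J, ∑ k ∈ J, ‖x j k‖ ^ 2 ≤ (2 * C * q * ‖ξ‖) ^ 2 := by
    set p : ℝ := 2 * (n - α) with hp
    have hp1 : 1 < p := by rw [hp]; linarith
    have hsq : ∀ j k, ‖x j k‖ ^ 2 ≤ C ^ 2 * (if j = k then 0 else |(j : ℝ) - k| ^ (-p)) * ‖e k ξ‖ ^ 2 := by
      intro j k
      have h1 := hf2 j k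
      have h2 : (C * if j = k then 0 else |(j : ℝ) - k| ^ (α - n)) ^ 2 =
          C ^ 2 * (if j = k then 0 else |(j : ℝ) - k| ^ (-p)) := by
        rw [mul_pow]
        split_ifs
        · simp
        · rw [← Real.rpow_mul_natCast (abs_nonneg _)]
          congr 2; rw [hp]; push_cast; ring
      rw [← h2, ← mul_pow]
      exact pow_le_pow_left₀ (norm_nonneg _) h1 2
    have hq2 : q ^ 2 = (p / (p - 1)) / 2 := by
      rw [hq, Real.sq_sqrt (div_nonneg (by linarith) (by linarith)), hp]
      have h1 : (2 * (n : ℝ) - 2 * α - 1) ≠ 0 := by linarith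
      rw [show 2 * ((n : ℝ) - α) - 1 = 2 * n - 2 * α - 1 by ring]
      field_simp
    rw [Finset.sum_comm]
    calc ∑ k ∈ J, ∑ j ∈ J, ‖x j k‖ ^ 2
        ≤ ∑ k ∈ J, ∑ j ∈ J, C ^ 2 * (if j = k then 0 else |(j : ℝ) - k| ^ (-p)) * ‖e k ξ‖ ^ 2 :=
          Finset.sum_le_sum (fun k _ => Finset.sum_le_sum (fun j _ => hsq j k))
      _ = ∑ k ∈ J, C ^ 2 * (∑ j ∈ J, (if j = k then 0 else |(j : ℝ) - k| ^ (-p))) * ‖e k ξ‖ ^ 2 := by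
          refine Finset.sum_congr rfl (fun k _ => ?_)
          rw [Finset.mul_sum, Finset.sum_mul]
      _ ≤ ∑ k ∈ J, C ^ 2 * (2 * (p / (p - 1))) * ‖e k ξ‖ ^ 2 := by
          refine Finset.sum_le_sum (fun k _ => ?_)
          have := CE_col_sum p hp1 J k
          gcongr
      _ = C ^ 2 * (2 * (p / (p - 1))) * ‖ξ‖ ^ 2 := by
          rw [← Finset.mul_sum, hnorm]
      _ = (2 * C * q * ‖ξ‖) ^ 2 := by
          rw [mul_pow, mul_pow, hq2]; ring
  have hq0 : 0 ≤ q := Real.sqrt_nonneg _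
  have hi : ∀ i, ‖∑ j ∈ J, ∑ k ∈ J, (inner ℂ (((fun z => D * z - z * D)^[i] y) (x j k))
          (CE_F D (fun t => ((t - b j k : ℝ) : ℂ) ^ (n - i)) (e j η)) : ℂ)‖ ≤
      ‖(fun z => D * z - z * D)^[i] y‖ * ((2 * C * q * ‖ξ‖) * ‖η‖) := by
    intro i
    calc _ ≤ ∑ j ∈ J, ‖∑ k ∈ J, (inner ℂ (((fun z => D * z - z * D)^[i] y) (x j k))
          (CE_F D (fun t => ((t - b j k : ℝ) : ℂ) ^ (n - i)) (e j η)) : ℂ)‖ := norm_sum_le _ _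
      _ ≤ ∑ j ∈ J, ‖(fun z => D * z - z * D)^[i] y‖ *
            (Real.sqrt (∑ k ∈ J, ‖x j k‖ ^ 2) * ‖e j η‖) := by
          refine Finset.sum_le_sum (fun j _ => ?_)
          exact CE_row hD J j (x j) (e j η) (hxorth j) (he6 j η) _ (n - i) (b j)
            (fun k hk => by simp [hb, hk]) (fun k hk => by simp only [hb, if_neg hk])
      _ = ‖(fun z => D * z - z * D)^[i] y‖ *
            ∑ j ∈ J, Real.sqrt (∑ k ∈ J, ‖x j k‖ ^ 2) * ‖e j η‖ := by rw [Finset.mul_sum]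
      _ ≤ _ := by
          gcongr
          refine (Real.sum_mul_le_sqrt_mul_sqrt _ _ _).trans ?_
          rw [hnorm, Real.sqrt_sq (norm_nonneg _)]
          gcongr
          apply Real.sqrt_le_iff.mpr
          refine ⟨by positivity, ?_⟩
          refine le_trans (le_of_eq ?_) hxsum
          refine Finset.sum_congr rfl (fun j _ => ?_)
          exact Real.sq_sqrt (Finset.sum_nonneg (fun _ _ => by positivity))
  have hfinal : (inner ℂ (T ξ) η : ℂ) = ∑ i ∈ Finset.range (n + 1),
      (((-1) ^ i * (n.choose i : ℤ) : ℤ) : ℂ) * ∑ j ∈ J, ∑ k ∈ J,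
        (inner ℂ (((fun z => D * z - z * D)^[i] y) (x j k))
          (CE_F D (fun t => ((t - b j k : ℝ) : ℂ) ^ (n - i)) (e j η)) : ℂ) := by
    rw [hTexp]
    simp only [hterm, Finset.mul_sum]
    rw [Finset.sum_comm (s := Finset.range (n + 1))]
    refine Finset.sum_congr rfl (fun j _ => ?_)
    rw [Finset.sum_comm]
  rw [hfinal, hS, Finset.sum_mul]
  refine (norm_sum_le _ _).trans (Finset.sum_le_sum (fun i _ => ?_))
  rw [norm_mul, mul_assoc]
  have : ‖(((-1) ^ i * (n.choose i : ℤ) : ℤ) : ℂ)‖ = (n.choose i : ℝ) := by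
    push_cast; rw [norm_mul, norm_pow, norm_neg, norm_one, one_pow, one_mul]; simp
  rw [this]
  gcongr
  exact hi i
end


/-- Theorem 5.2 of the paper (for a bounded self-adjoint `D`): a commutator
estimate for `[g(D), y]` when `g` is `(α, A, B)` Hölder bounded. Here `g(D)` is
given by the continuous functional calculus of the self-adjoint operator `D`. -/
theorem commutator_estimate_holder_bounded
    {H : Type*} [NormedAddCommGroup H] [InnerProductSpace ℂ H] [CompleteSpace H]
    (D : H →L[ℂ] H) (hD : IsSelfAdjoint D)
    (α A B : ℝ) (hα : 0 < α) (hA : 0 ≤ A) (hB : 0 ≤ B)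
    (g : ℝ → ℂ) (hgcont : Continuous g)
    (hg : ∀ s t : ℝ, ‖g s - g t‖ ≤ A + B * |s - t| ^ α)
    (n : ℕ) (hn : (n : ℝ) > α + 1 / 2)
    (y : H →L[ℂ] H) :
    ‖cfc (fun z : ℂ => g z.re) D * y - y * cfc (fun z : ℂ => g z.re) D‖ ≤
      2 * (A + B) * (‖y‖ +
        Real.sqrt ((n - α) / (2 * n - 2 * α - 1)) *
          ∑ k ∈ Finset.range (n + 1),
            (n.choose k : ℝ) * ‖(fun z => D * z - z * D)^[k] y‖) := by
  obtain ⟨N, e, he1, he2, he3, he4, he5, he6⟩ := CE_exists_proj hD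
  set J := Finset.Ico (-(N : ℤ)) N with hJ
  have horth : ∀ j k : ℤ, j ≠ k → ∀ u v : H, inner ℂ (e j u) (e k v) = 0 := by
    intro j k hjk u v
    rw [he1, ← mul_apply_eq_comp, he3 j k hjk]; simp
  have hdec : ∀ v : H, ∑ j ∈ J, e j v = v := by
    intro v
    have := congrArg (fun T : H →L[ℂ] H => T v) he4
    simpa using this
  have hnorm : ∀ v : H, ∑ j ∈ J, ‖e j v‖ ^ 2 = ‖v‖ ^ 2 := by
    intro v
    rw [← CE_pyth J (fun j => e j v) (fun j _ k _ hjk => horth j k hjk v v), hdec]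
  have hdisc := CE_discrete hD J e he1 he3 he4 he5 he6 α (A + B) (by positivity)
    (fun j => g j) (by
      intro j k hjk
      refine (hg j k).trans ?_
      have h1 : (1 : ℝ) ≤ |(j : ℝ) - k| := by
        have : (1 : ℤ) ≤ |j - k| := Int.one_le_abs (sub_ne_zero.mpr hjk)
        exact_mod_cast this
      have h2 : 1 ≤ |(j : ℝ) - k| ^ α := Real.one_le_rpow h1 hα.le
      nlinarith) n hn y
  change ‖CE_F D g * y - y * CE_F D g‖ ≤ _
  set G := ∑ j ∈ J, g j • e j with hG
  have hdiff : ‖CE_F D g - G‖ ≤ A + B := by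
    refine ContinuousLinearMap.opNorm_le_bound _ (by positivity) (fun v => ?_)
    have h1 : (CE_F D g - G) v = ∑ j ∈ J, CE_F D (fun t => g t - g j) (e j v) := by
      have h2 : ∀ j ∈ J, CE_F D (fun t => g t - g j) (e j v) = CE_F D g (e j v) - g j • e j v := by
        intro j _
        rw [CE_sub hgcont continuous_const, CE_const hD]; simp
      rw [Finset.sum_congr rfl h2, Finset.sum_sub_distrib, ← map_sum, hdec, hG]; simp
    rw [h1]
    refine (pow_le_pow_iff_left₀ (norm_nonneg _) (by positivity) two_ne_zero).mp ?_
    rw [CE_pyth]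
    · rw [mul_pow, ← hnorm, Finset.mul_sum]
      refine Finset.sum_le_sum (fun j _ => ?_)
      rw [← mul_pow]
      refine pow_le_pow_left₀ (norm_nonneg _) ?_ 2
      refine CE_bound hD (w := fun t => max ((j : ℝ) - t) 0 + max (t - (j + 1)) 0)
        (hgcont.sub continuous_const) (by fun_prop)
        (fun t => add_nonneg (le_max_right _ _) (le_max_right _ _)) _ (by positivity) ?_ _ (he6 j v)
      intro t _ ht
      obtain ⟨h3, h4⟩ := CE_w_zero ht
      refine (hg t j).trans ?_
      have h5 : |t - (j : ℝ)| ^ α ≤ 1 := by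
        apply Real.rpow_le_one (abs_nonneg _) _ hα.le
        rw [abs_of_nonneg (by linarith)]; linarith
      nlinarith
    · intro j _ k _ hjk
      rw [← mul_apply_eq_comp, ← mul_apply_eq_comp, ← he5, ← he5, mul_apply_eq_comp,
        mul_apply_eq_comp]
      exact horth j k hjk _ _
  have hsplit : CE_F D g * y - y * CE_F D g =
      ((CE_F D g - G) * y - y * (CE_F D g - G)) + (G * y - y * G) := by
    rw [sub_mul, mul_sub]; abel
  have hfirst : ‖(CE_F D g - G) * y - y * (CE_F D g - G)‖ ≤ 2 * (A + B) * ‖y‖ := by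
    have h1 : ‖(CE_F D g - G) * y‖ ≤ (A + B) * ‖y‖ :=
      (norm_mul_le _ _).trans (by gcongr)
    have h2 : ‖y * (CE_F D g - G)‖ ≤ ‖y‖ * (A + B) :=
      (norm_mul_le _ _).trans (by gcongr)
    have := norm_sub_le ((CE_F D g - G) * y) (y * (CE_F D g - G))
    linarith
  rw [hsplit, mul_add]
  exact (norm_add_le _ _).trans (add_le_add hfirst hdisc)
end

section
/- Let β > 0 and define g_β : ℝ → ℝ by g_β(t) = log t for t ≥ β and g_β(t) = log β for t < β. Let D be a bounded positive (self-adjoint, nonnegative) operator on a complex Hilbert space H and y a bounded operator on H. Then ‖[g_β(D), y]‖ ≤ (1/β)^{1/3} · ( 8‖y‖ + 5‖[D, y]‖ ). -/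
theorem gb_pow_comm {A : Type*} [Ring A] (D y : A) (n : ℕ) :
    D ^ n * y - y * D ^ n =
      ∑ i ∈ Finset.range n, D ^ i * (D * y - y * D) * D ^ (n - 1 - i) := by
  induction n with
  | zero => simp
  | succ n ih =>
    have h1 : D ^ (n + 1) * y - y * D ^ (n + 1)
        = (D ^ n * y - y * D ^ n) * D + D ^ n * (D * y - y * D) := by
      rw [pow_succ]; noncomm_ring
    rw [h1, ih, Finset.sum_range_succ, Finset.sum_mul]
    congr 1
    · apply Finset.sum_congr rfl
      intro i hi
      have hi' := Finset.mem_range.mp hi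
      have : n + 1 - 1 - i = (n - 1 - i) + 1 := by omega
      rw [this, pow_succ, ← mul_assoc]
    · simp

theorem gb_scalar (p t : ℝ) (hp : 0 < p) (ht : 0 ≤ t) (i n : ℕ) (hi : i ≤ n) :
    t ^ i / (p ^ n + t ^ n) ≤ p ^ i / p ^ n := by
  have hpn : 0 < p ^ n := by positivity
  rw [div_le_div_iff₀ (by positivity) hpn]
  obtain ⟨k, rfl⟩ := Nat.exists_eq_add_of_le hi
  have h : t ^ i * p ^ k ≤ p ^ (i + k) + t ^ (i + k) := by
    rcases le_total t p with h | h
    · have : t ^ i * p ^ k ≤ p ^ i * p ^ k := by gcongr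
      rw [pow_add p]; have : 0 ≤ t ^ (i + k) := by positivity
      linarith
    · have : t ^ i * p ^ k ≤ t ^ i * t ^ k := by gcongr
      rw [pow_add t]; have : 0 ≤ p ^ (i + k) := by positivity
      linarith
  calc t ^ i * p ^ (i + k) = p ^ i * (t ^ i * p ^ k) := by rw [pow_add]; ring
    _ ≤ _ := by gcongr

section
variable {H : Type*} [NormedAddCommGroup H] [InnerProductSpace ℂ H] [CompleteSpace H]

theorem gb_small (D y : H →L[ℂ] H) (f : ℝ → ℝ) (c : ℝ) (hc : 0 ≤ c)
    (h : ∀ t ∈ spectrum ℝ D, |f t| ≤ c) :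
    ‖cfc f D * y - y * cfc f D‖ ≤ 2 * c * ‖y‖ := by
  have h1 : ‖cfc f D‖ ≤ c := norm_cfc_le hc h
  calc _ ≤ ‖cfc f D * y‖ + ‖y * cfc f D‖ := norm_sub_le _ _
    _ ≤ ‖cfc f D‖ * ‖y‖ + ‖y‖ * ‖cfc f D‖ := add_le_add (norm_mul_le _ _) (norm_mul_le _ _)
    _ ≤ c * ‖y‖ + ‖y‖ * c := by gcongr
    _ = _ := by ring

theorem gb_resolvent (D : H →L[ℂ] H) (hD : IsSelfAdjoint D) (hS : ∀ t ∈ spectrum ℝ D, 0 ≤ t)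
    (y : H →L[ℂ] H) (p : ℝ) (hp : 0 < p) (m : ℕ) :
    ‖cfc (fun t : ℝ => p ^ m / (p ^ (m + 1) + t ^ (m + 1))) D * y -
      y * cfc (fun t : ℝ => p ^ m / (p ^ (m + 1) + t ^ (m + 1))) D‖ ≤
      (m + 1 : ℝ) * ‖D * y - y * D‖ * (p ^ 2)⁻¹ := by
  set n := m + 1 with hn
  have hpos : ∀ t ∈ spectrum ℝ D, 0 < p ^ n + t ^ n := fun t ht => by
    have := hS t ht
    positivity
  have hcq : ContinuousOn (fun t : ℝ => (p ^ n + t ^ n)⁻¹) (spectrum ℝ D) :=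
    ContinuousOn.inv₀ (by fun_prop) fun t ht => (hpos t ht).ne'
  set Q := cfc (fun t : ℝ => (p ^ n + t ^ n)⁻¹) D with hQ
  set P := cfc (fun t : ℝ => p ^ n + t ^ n) D with hP
  have hPD : P = algebraMap ℝ (H →L[ℂ] H) (p ^ n) + D ^ n := by
    rw [hP, cfc_const_add (p ^ n) (fun t => t ^ n) D, cfc_pow_id D n]
  have hQP : Q * P = 1 := by
    rw [hQ, hP, ← cfc_mul _ _ D hcq, ← cfc_one ℝ D]
    exact cfc_congr fun t ht => inv_mul_cancel₀ (hpos t ht).ne'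
  have hPQ : P * Q = 1 := by
    rw [hQ, hP, ← cfc_mul _ _ D (by fun_prop) hcq, ← cfc_one ℝ D]
    exact cfc_congr fun t ht => mul_inv_cancel₀ (hpos t ht).ne'
  have hbd : ∀ i ≤ n, ‖Q * D ^ i‖ ≤ p ^ i / p ^ n := by
    intro i hi
    rw [← cfc_pow_id (R := ℝ) D i, hQ, ← cfc_mul _ _ D hcq]
    refine norm_cfc_le (by positivity) fun t ht => ?_
    have := hS t ht
    rw [Real.norm_of_nonneg (by positivity), inv_mul_eq_div]
    exact gb_scalar p t hp this i n hi
  have hbd' : ∀ i ≤ n, ‖D ^ i * Q‖ ≤ p ^ i / p ^ n := by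
    intro i hi
    rw [← cfc_pow_id (R := ℝ) D i, hQ, ← cfc_mul _ _ D (by fun_prop) hcq]
    refine norm_cfc_le (by positivity) fun t ht => ?_
    have := hS t ht
    rw [Real.norm_of_nonneg (by positivity), ← div_eq_mul_inv]
    exact gb_scalar p t hp this i n hi
  have key : Q * y - y * Q = - (Q * (D ^ n * y - y * D ^ n) * Q) := by
    have e1 : D ^ n * y - y * D ^ n = P * y - y * P := by
      rw [hPD, add_mul, mul_add, Algebra.commutes (p ^ n) y]; abel
    rw [e1]
    have e2 : Q * (P * y - y * P) * Q = (Q * P) * y * Q - Q * y * (P * Q) := by noncomm_ring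
    rw [e2, hQP, hPQ]; simp
  have hmain : ‖Q * y - y * Q‖ ≤ n * (‖D * y - y * D‖ * (p ^ m / (p ^ n * p ^ n))) := by
    rw [key, norm_neg, gb_pow_comm, Finset.mul_sum, Finset.sum_mul]
    refine (norm_sum_le _ _).trans ?_
    refine (Finset.sum_le_card_nsmul _ _ (‖D * y - y * D‖ * (p ^ m / (p ^ n * p ^ n))) ?_).trans ?_
    · intro i hi
      have hi' := Finset.mem_range.mp hi
      have e : Q * (D ^ i * (D * y - y * D) * D ^ (n - 1 - i)) * Q
        = (Q * D ^ i) * (D * y - y * D) * (D ^ (n - 1 - i) * Q) := by noncomm_ring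
      rw [e]
      calc _ ≤ ‖Q * D ^ i‖ * ‖D * y - y * D‖ * ‖D ^ (n - 1 - i) * Q‖ :=
            norm_mul₃_le
        _ ≤ (p ^ i / p ^ n) * ‖D * y - y * D‖ * (p ^ (n - 1 - i) / p ^ n) := by
            gcongr
            · exact hbd i (by omega)
            · exact hbd' _ (by omega)
        _ = _ := by
            have : m = i + (n - 1 - i) := by omega
            conv_rhs => rw [this, pow_add]
            ring
    · simp
  have e3 : cfc (fun t : ℝ => p ^ m / (p ^ n + t ^ n)) D = p ^ m • Q := by
    rw [hQ, ← cfc_const_mul (p ^ m) _ D hcq]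
    simp only [div_eq_mul_inv]
  rw [e3, smul_mul_assoc, mul_smul_comm, ← smul_sub, norm_smul, Real.norm_of_nonneg (by positivity)]
  calc _ ≤ p ^ m * (n * (‖D * y - y * D‖ * (p ^ m / (p ^ n * p ^ n)))) := by gcongr
    _ = _ := by
      rw [hn]; push_cast; field_simp; ring

theorem gb_int_mul_const {μ : MeasureTheory.Measure ℝ} {f : ℝ → H →L[ℂ] H} {y : H →L[ℂ] H}
    (hf : MeasureTheory.Integrable f μ) : ∫ p, f p * y ∂μ = (∫ p, f p ∂μ) * y :=
  ((ContinuousLinearMap.mul ℝ (H →L[ℂ] H)).flip y).integral_comp_comm hf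

theorem gb_int_const_mul {μ : MeasureTheory.Measure ℝ} {f : ℝ → H →L[ℂ] H} {y : H →L[ℂ] H}
    (hf : MeasureTheory.Integrable f μ) : ∫ p, y * f p ∂μ = y * (∫ p, f p ∂μ) :=
  (ContinuousLinearMap.mul ℝ (H →L[ℂ] H) y).integral_comp_comm hf

theorem gb_log (D : H →L[ℂ] H) (hD : IsSelfAdjoint D) (hS : ∀ t ∈ spectrum ℝ D, 0 ≤ t)
    (y : H →L[ℂ] H) (κ R : ℝ) (hκ : 0 < κ) (hR : κ ≤ R) (m : ℕ) :
    ‖cfc (fun t : ℝ => Real.log (R ^ (m + 1) + t ^ (m + 1)) / (m + 1)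
        - Real.log (κ ^ (m + 1) + t ^ (m + 1)) / (m + 1)) D * y -
      y * cfc (fun t : ℝ => Real.log (R ^ (m + 1) + t ^ (m + 1)) / (m + 1)
        - Real.log (κ ^ (m + 1) + t ^ (m + 1)) / (m + 1)) D‖ ≤
      (m + 1 : ℝ) * ‖D * y - y * D‖ * κ⁻¹ := by
  set f : ℝ → ℝ → ℝ := fun p t => p ^ m / (p ^ (m + 1) + t ^ (m + 1)) with hf
  have hcont : ∀ t, 0 ≤ t → ContinuousOn (fun p => f p t) (Set.uIcc κ R) := by
    intro t ht
    rw [Set.uIcc_of_le hR]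
    refine ContinuousOn.div (by fun_prop) (by fun_prop) fun p hp => ?_
    have : 0 < p := hκ.trans_le hp.1
    positivity
  have hcfc : cfc (fun t : ℝ => Real.log (R ^ (m + 1) + t ^ (m + 1)) / (m + 1)
        - Real.log (κ ^ (m + 1) + t ^ (m + 1)) / (m + 1)) D
      = cfc (fun t => ∫ p in Set.Ioc κ R, f p t) D := by
    refine cfc_congr fun t ht => ?_
    have ht := hS t ht
    rw [← intervalIntegral.integral_of_le hR]
    symm
    refine intervalIntegral.integral_eq_sub_of_hasDerivAt
      (f := fun p => Real.log (p ^ (m + 1) + t ^ (m + 1)) / (m + 1)) ?_ (hcont t ht).intervalIntegrable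
    intro p hp
    rw [Set.uIcc_of_le hR] at hp
    have hp0 : 0 < p := hκ.trans_le hp.1
    have hne : p ^ (m + 1) + t ^ (m + 1) ≠ 0 := by positivity
    have := (((hasDerivAt_pow (m + 1) p).add_const (t ^ (m + 1))).log hne).div_const ((m : ℝ) + 1)
    have e : f p t = ((m + 1 : ℕ) : ℝ) * p ^ (m + 1 - 1) / (p ^ (m + 1) + t ^ (m + 1)) / ((m : ℝ) + 1) := by
      have : (m : ℝ) + 1 ≠ 0 := by positivity
      simp only [hf, Nat.add_sub_cancel]
      push_cast
      field_simp
    rw [e]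
    exact this
  have hjoint : ContinuousOn (Function.uncurry f) (Set.Ioc κ R ×ˢ spectrum ℝ D) := by
    refine ContinuousOn.div (by fun_prop) (by fun_prop) ?_
    rintro ⟨p, t⟩ ⟨hp, ht⟩
    have : 0 < p := hκ.trans hp.1
    have := hS t ht
    simp only
    positivity
  have hbound : ∀ᵐ p ∂(MeasureTheory.volume.restrict (Set.Ioc κ R)),
      ∀ z ∈ spectrum ℝ D, ‖f p z‖ ≤ (fun _ : ℝ => κ⁻¹) p := by
    refine MeasureTheory.ae_restrict_of_forall_mem measurableSet_Ioc fun p hp t ht => ?_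
    have hp0 : 0 < p := hκ.trans hp.1
    have ht := hS t ht
    simp only [hf]
    rw [Real.norm_of_nonneg (by positivity)]
    calc p ^ m / (p ^ (m + 1) + t ^ (m + 1)) ≤ p ^ m / p ^ (m + 1) := by
          gcongr; have : 0 ≤ t ^ (m + 1) := by positivity
          linarith
      _ = p⁻¹ := by rw [pow_succ]; field_simp
      _ ≤ κ⁻¹ := by gcongr; exact hp.1.le
  have hfin : MeasureTheory.HasFiniteIntegral (fun _ : ℝ => κ⁻¹)
      (MeasureTheory.volume.restrict (Set.Ioc κ R)) :=
    (MeasureTheory.integrable_const _).hasFiniteIntegral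
  have hint := integrableOn_cfc measurableSet_Ioc f _ D hjoint hbound hfin hD
  rw [hcfc, cfc_setIntegral measurableSet_Ioc f _ D hjoint hbound hfin hD]
  rw [← gb_int_mul_const hint,
    ← gb_int_const_mul hint,
    ← MeasureTheory.integral_sub (hint.mul_const y) (hint.const_mul y),
    ← intervalIntegral.integral_of_le hR]
  have hi2 : IntervalIntegrable (fun p : ℝ => (m + 1 : ℝ) * ‖D * y - y * D‖ * (p ^ 2)⁻¹)
      MeasureTheory.volume κ R := by
    apply ContinuousOn.intervalIntegrable
    rw [Set.uIcc_of_le hR]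
    refine ContinuousOn.mul continuousOn_const (ContinuousOn.inv₀ (by fun_prop) fun p hp => ?_)
    have : 0 < p := hκ.trans_le hp.1
    positivity
  refine (intervalIntegral.norm_integral_le_of_norm_le hR
    (Filter.Eventually.of_forall fun p hp =>
      gb_resolvent D hD hS y p (hκ.trans hp.1) m) hi2).trans ?_
  rw [intervalIntegral.integral_const_mul]
  have : ∫ p in κ..R, (p ^ 2)⁻¹ = - R⁻¹ - (- κ⁻¹) := by
    refine intervalIntegral.integral_eq_sub_of_hasDerivAt (f := fun p => - p⁻¹) ?_ ?_
    · intro p hp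
      rw [Set.uIcc_of_le hR] at hp
      have hp0 : p ≠ 0 := (hκ.trans_le hp.1).ne'
      have := (hasDerivAt_inv hp0).fun_neg
      simpa using this
    · apply ContinuousOn.intervalIntegrable
      rw [Set.uIcc_of_le hR]
      refine ContinuousOn.inv₀ (by fun_prop) fun p hp => ?_
      have : 0 < p := hκ.trans_le hp.1
      positivity
  rw [this]
  gcongr
  have : 0 < R⁻¹ := by have := hκ.trans_le hR; positivity
  linarith

theorem gb_bound (D : H →L[ℂ] H) (hD : IsSelfAdjoint D) (hS : ∀ t ∈ spectrum ℝ D, 0 ≤ t)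
    (y : H →L[ℂ] H) (β κ ε ω : ℝ) (hβ : 0 < β) (hκ : β ≤ κ) (hε : 0 < ε) (m : ℕ)
    (hω : Real.log (1 + (κ / β) ^ (m + 1)) / (m + 1) ≤ ω) :
    ‖cfc (fun t : ℝ => if β ≤ t then Real.log t else Real.log β) D * y -
        y * cfc (fun t : ℝ => if β ≤ t then Real.log t else Real.log β) D‖ ≤
      2 * (ω + ε) * ‖y‖ + (m + 1 : ℝ) * ‖D * y - y * D‖ * κ⁻¹ := by
  have hκ0 : 0 < κ := hβ.trans_le hκ
  have hm : (0 : ℝ) < m + 1 := by positivity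
  set T := ‖D‖ * ‖(1 : H →L[ℂ] H)‖ with hT
  have hST : ∀ t ∈ spectrum ℝ D, t ≤ T := fun t ht =>
    (le_abs_self t).trans (spectrum.norm_le_norm_mul_of_mem ht)
  have hT0 : 0 ≤ T := by positivity
  set R := κ + T + T / ε with hRdef
  have hTe : 0 ≤ T / ε := by positivity
  have hκR : κ ≤ R := by linarith
  have hR0 : 0 < R := by linarith
  have hω0 : 0 ≤ ω := by
    refine le_trans ?_ hω
    have : 0 ≤ Real.log (1 + (κ / β) ^ (m + 1)) := Real.log_nonneg (by
      have : 0 ≤ (κ / β) ^ (m + 1) := by positivity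
      linarith)
    positivity
  have hg : (fun t : ℝ => if β ≤ t then Real.log t else Real.log β)
      = fun t => Real.log (max β t) := by
    funext t
    split_ifs with h
    · rw [max_eq_right h]
    · rw [max_eq_left (le_of_not_ge h)]
  rw [hg]
  set h : ℝ → ℝ → ℝ := fun p t => Real.log (p ^ (m + 1) + t ^ (m + 1)) / (m + 1) with hh
  set F : ℝ → ℝ := fun t => h R t - h κ t with hF
  set G : ℝ → ℝ := fun t => (Real.log (max β t) - h κ t) + (h R t - Real.log R) with hG
  have hhc : ∀ p, 0 < p → ContinuousOn (h p) (spectrum ℝ D) := by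
    intro p hp
    refine ContinuousOn.div_const (ContinuousOn.log (by fun_prop) fun t ht => ?_) _
    have := hS t ht
    positivity
  have hgc : ContinuousOn (fun t => Real.log (max β t)) (spectrum ℝ D) := by
    refine ContinuousOn.log (by fun_prop) fun t ht => ?_
    exact (hβ.trans_le (le_max_left _ _)).ne'
  have hFc : ContinuousOn F (spectrum ℝ D) := (hhc R hR0).sub (hhc κ hκ0)
  have hGc : ContinuousOn G (spectrum ℝ D) :=
    (hgc.sub (hhc κ hκ0)).add ((hhc R hR0).sub continuousOn_const)
  have hdec : cfc (fun t => Real.log (max β t)) D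
      = cfc G D - cfc F D + algebraMap ℝ (H →L[ℂ] H) (Real.log R) := by
    rw [← cfc_sub G F D hGc hFc, ← cfc_add_const (Real.log R) (fun x => G x - F x) D (hGc.sub hFc)]
    congr 1
    funext t
    simp only [hG, hF]; ring
  have hFb := gb_log D hD hS y κ R hκ0 hκR m
  have hGb : ‖cfc G D * y - y * cfc G D‖ ≤ 2 * (ω + ε) * ‖y‖ := by
    refine gb_small D y G (ω + ε) (by positivity) fun t ht => ?_
    have ht0 := hS t ht
    have htT := hST t ht
    have hq : 0 ≤ h R t - Real.log R ∧ h R t - Real.log R ≤ ε := by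
      have e : h R t - Real.log R = Real.log (1 + (t / R) ^ (m + 1)) / (m + 1) := by
        have e1 : R ^ (m + 1) + t ^ (m + 1) = R ^ (m + 1) * (1 + (t / R) ^ (m + 1)) := by
          rw [div_pow]; field_simp
        simp only [hh]
        rw [e1, Real.log_mul (by positivity) (by positivity), Real.log_pow]
        push_cast; field_simp; ring
      have hx0 : 0 ≤ (t / R) ^ (m + 1) := by positivity
      have hx1 : t / R ≤ 1 := by rw [div_le_one hR0]; linarith
      have hx2 : (t / R) ^ (m + 1) ≤ t / R := pow_le_of_le_one (by positivity) hx1 (by omega)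
      have hx3 : t / R ≤ ε := by
        rw [div_le_iff₀ hR0]
        have : ε * (T / ε) = T := by field_simp
        have h2 : 0 ≤ ε * (κ + T) := by positivity
        rw [hRdef]; nlinarith
      have hl0 : 0 ≤ Real.log (1 + (t / R) ^ (m + 1)) := Real.log_nonneg (by linarith)
      have hl1 := Real.log_le_sub_one_of_pos (show 0 < 1 + (t / R) ^ (m + 1) by positivity)
      rw [e]
      refine ⟨by positivity, (div_le_self hl0 (by
        have : (0 : ℝ) ≤ m := by positivity
        linarith)).trans (by linarith)⟩
    have hr : Real.log (max β t) - h κ t ≤ 0 ∧ - ω ≤ Real.log (max β t) - h κ t := by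
      set M := max β t with hM
      have hM0 : 0 < M := hβ.trans_le (le_max_left _ _)
      have e : Real.log M = Real.log (M ^ (m + 1)) / (m + 1) := by
        rw [Real.log_pow]; push_cast; field_simp
      have hMle : M ^ (m + 1) ≤ κ ^ (m + 1) + t ^ (m + 1) := by
        rcases max_choice β t with hc | hc
        · rw [hM, hc]
          have : β ^ (m + 1) ≤ κ ^ (m + 1) := by gcongr
          have : 0 ≤ t ^ (m + 1) := by positivity
          linarith
        · rw [hM, hc]
          have : 0 ≤ κ ^ (m + 1) := by positivity
          linarith
      have hle2 : κ ^ (m + 1) + t ^ (m + 1) ≤ M ^ (m + 1) * (1 + (κ / β) ^ (m + 1)) := by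
        have h1 : t ^ (m + 1) ≤ M ^ (m + 1) := by gcongr; exact le_max_right _ _
        have h2 : κ ^ (m + 1) ≤ M ^ (m + 1) * (κ / β) ^ (m + 1) := by
          rw [← mul_pow]
          gcongr
          rw [mul_div_assoc', le_div_iff₀ hβ, mul_comm]
          gcongr
          exact le_max_left _ _
        linarith
      constructor
      · rw [e, sub_nonpos]
        simp only [hh]
        gcongr
      · have h3 : h κ t ≤ Real.log M + Real.log (1 + (κ / β) ^ (m + 1)) / (m + 1) := by
          rw [e, ← add_div, ← Real.log_mul (by positivity) (by positivity)]
          simp only [hh]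
          gcongr
        linarith
    simp only [hG]
    rw [abs_le]
    constructor <;> linarith [hq.1, hq.2, hr.1, hr.2]
  have hsplit : cfc (fun t => Real.log (max β t)) D * y - y * cfc (fun t => Real.log (max β t)) D
      = (cfc G D * y - y * cfc G D) - (cfc F D * y - y * cfc F D) := by
    rw [hdec, add_mul, mul_add, Algebra.commutes (Real.log R) y]
    noncomm_ring
  rw [hsplit]
  exact (norm_sub_le _ _).trans (add_le_add hGb hFb)

end

/-- Proposition 6.1 of the paper (for a bounded positive `D`):
`‖[g_β(D), y]‖ ≤ (1/β)^{1/3}(8‖y‖ + 5‖[D,y]‖)`, where `g_β(t) = log t` for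
`t ≥ β` and `g_β(t) = log β` for `t < β`. -/
theorem commutator_estimate_gbeta
    {H : Type*} [NormedAddCommGroup H] [InnerProductSpace ℂ H] [CompleteSpace H]
    (D : H →L[ℂ] H) (hD : IsSelfAdjoint D) (hDpos : 0 ≤ D)
    (β : ℝ) (hβ : 0 < β) (y : H →L[ℂ] H) :
    ‖cfc (fun t : ℝ => if β ≤ t then Real.log t else Real.log β) D * y -
        y * cfc (fun t : ℝ => if β ≤ t then Real.log t else Real.log β) D‖ ≤
      (1 / β) ^ ((1 : ℝ) / 3) * (8 * ‖y‖ + 5 * ‖D * y - y * D‖) := by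
  have hS : ∀ t ∈ spectrum ℝ D, 0 ≤ t := fun t ht => spectrum_nonneg_of_nonneg hDpos ht
  obtain ⟨u, hu, rfl⟩ : ∃ u : ℝ, 0 < u ∧ u ^ 3 = β :=
    ⟨β ^ ((1 : ℝ) / 3), by positivity, by
      rw [← Real.rpow_natCast, ← Real.rpow_mul hβ.le]; norm_num⟩
  have hv : (1 / u ^ 3) ^ ((1 : ℝ) / 3) = u⁻¹ := by
    rw [one_div, ← inv_pow, ← Real.rpow_natCast, ← Real.rpow_mul (by positivity)]; norm_num
  rw [hv]
  have hv0 : 0 < u⁻¹ := by positivity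
  have ha := norm_nonneg y
  have hb := norm_nonneg (D * y - y * D)
  rcases le_total u 1 with h1 | h1
  · have hκ : u ^ 3 ≤ u := pow_le_of_le_one hu.le h1 (by norm_num)
    have hω : Real.log (1 + (u / u ^ 3) ^ (0 + 1)) / ((0 : ℕ) + 1) ≤ 2 * u⁻¹ := by
      have e : (u / u ^ 3) ^ (0 + 1) = u⁻¹ ^ 2 := by
        rw [zero_add, pow_one]; field_simp
      rw [e]
      have h2 : Real.log (1 + u⁻¹ ^ 2) ≤ Real.log ((1 + u⁻¹) ^ 2) :=
        Real.log_le_log (by positivity) (by nlinarith)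
      rw [Real.log_pow] at h2
      have h3 := Real.log_le_sub_one_of_pos (show 0 < 1 + u⁻¹ by positivity)
      push_cast at h2 ⊢
      simp only [zero_add, div_one]
      linarith
    refine (gb_bound D hD hS y (u ^ 3) u u⁻¹ (2 * u⁻¹) hβ hκ hv0 0 hω).trans ?_
    have := mul_nonneg ha hv0.le
    have := mul_nonneg hb hv0.le
    push_cast
    nlinarith
  · obtain ⟨m, hm1, hm2⟩ : ∃ m : ℕ, u ≤ m + 1 ∧ (m : ℝ) + 1 ≤ 2 * u :=
      ⟨⌊u⌋₊, (Nat.lt_floor_add_one u).le, by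
        have := Nat.floor_le hu.le
        linarith⟩
    have hω : Real.log (1 + (u ^ 3 / u ^ 3) ^ (m + 1)) / (m + 1) ≤ u⁻¹ := by
      rw [div_self hβ.ne', one_pow]
      have h3 := Real.log_le_sub_one_of_pos (show (0 : ℝ) < 1 + 1 by norm_num)
      rw [inv_eq_one_div]
      gcongr
      linarith
    refine (gb_bound D hD hS y (u ^ 3) (u ^ 3) u⁻¹ u⁻¹ hβ le_rfl hv0 m hω).trans ?_
    have h4 : ((m : ℝ) + 1) * (u ^ 3)⁻¹ ≤ 2 * u⁻¹ := by
      calc ((m : ℝ) + 1) * (u ^ 3)⁻¹ ≤ (2 * u) * (u ^ 3)⁻¹ := by gcongr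
        _ = 2 * u⁻¹ * u⁻¹ := by field_simp
        _ ≤ 2 * u⁻¹ * 1 := by
          gcongr
          exact inv_le_one_of_one_le₀ h1
        _ = _ := by ring
    have h5 := mul_le_mul_of_nonneg_left h4 hb
    have := mul_nonneg ha hv0.le
    have := mul_nonneg hb hv0.le
    nlinarith
end

section
/- Let D be a bounded self-adjoint operator on a complex Hilbert space H and y a bounded operator on H, and let |D| denote the absolute value of D. Then ‖[|D|, y]‖ ≤ 4‖y‖ + 4‖[D, y]‖ + 2‖[D, [D, y]]‖. -/
open Real in
/-- Elementary two-sided estimate of an increment of the arctangent. -/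
lemma arctan_incr {u v : ℝ} (hu : 0 ≤ u) (huv : u ≤ v) :
    (v - u) / (1 + v ^ 2) ≤ arctan v - arctan u ∧
      arctan v - arctan u ≤ (v - u) / (1 + u ^ 2) := by
  have hd : ∀ x, deriv arctan x = 1 / (1 + x ^ 2) := fun x => by simp
  have hdiff : Differentiable ℝ arctan := Real.differentiable_arctan
  constructor
  · have := (convex_Icc u v).mul_sub_le_image_sub_of_le_deriv (f := arctan)
      (C := 1 / (1 + v ^ 2)) hdiff.continuous.continuousOn hdiff.differentiableOn
      (by
        intro x hx
        rw [interior_Icc] at hx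
        rw [hd]
        have h1 := hx.1
        have h2 := hx.2
        apply one_div_le_one_div_of_le (by positivity)
        nlinarith) u ⟨le_rfl, huv⟩ v ⟨huv, le_rfl⟩ huv
    calc _ = 1 / (1 + v ^ 2) * (v - u) := by ring
      _ ≤ _ := this
  · have := (convex_Icc u v).image_sub_le_mul_sub_of_deriv_le (f := arctan)
      (C := 1 / (1 + u ^ 2)) hdiff.continuous.continuousOn hdiff.differentiableOn
      (by
        intro x hx
        rw [interior_Icc] at hx
        rw [hd]
        have h1 := hx.1
        have h2 := hx.2
        apply one_div_le_one_div_of_le (by positivity)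
        nlinarith) u ⟨le_rfl, huv⟩ v ⟨huv, le_rfl⟩ huv
    calc _ ≤ _ := this
      _ = _ := by ring

open Real in
lemma arctan_incr_scaled {t a b : ℝ} (ht : 0 < t) (ha : 0 ≤ a) (hab : a ≤ b) :
    (b - a) * (t / (t ^ 2 + b ^ 2)) ≤ arctan (b / t) - arctan (a / t) ∧
      arctan (b / t) - arctan (a / t) ≤ (b - a) * (t / (t ^ 2 + a ^ 2)) := by
  have h := arctan_incr (u := a / t) (v := b / t) (by positivity) (by gcongr)
  have key : ∀ c : ℝ, (b / t - a / t) / (1 + (c / t) ^ 2) = (b - a) * (t / (t ^ 2 + c ^ 2)) := by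
    intro c
    have : t ^ 2 + c ^ 2 ≠ 0 := by positivity
    have : 1 + (c / t) ^ 2 ≠ 0 := by positivity
    field_simp
  rwa [key, key] at h

open Real in
lemma sum_upper {t : ℝ} (ht : 0 < t) (n : ℕ) :
    ∑ k ∈ Finset.range n, 2 * (t / (t ^ 2 + (2 * ((k : ℝ) + 1)) ^ 2)) ≤ arctan (2 * (n : ℝ) / t) := by
  induction n with
  | zero => simp
  | succ n ih =>
    rw [Finset.sum_range_succ]
    have := (arctan_incr_scaled (a := 2 * (n : ℝ)) (b := 2 * ((n : ℝ) + 1)) ht (by positivity)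
      (by linarith)).1
    push_cast
    rw [show 2 * ((n : ℝ) + 1) - 2 * n = 2 by ring] at this
    linarith

open Real in
lemma sum_lower {t : ℝ} (ht : 0 < t) (n : ℕ) :
    arctan (2 * ((n : ℝ) + 1) / t) - arctan (2 / t) ≤
      ∑ k ∈ Finset.range n, 2 * (t / (t ^ 2 + (2 * ((k : ℝ) + 1)) ^ 2)) := by
  induction n with
  | zero => simp
  | succ n ih =>
    rw [Finset.sum_range_succ]
    have := (arctan_incr_scaled (a := 2 * ((n : ℝ) + 1)) (b := 2 * ((n : ℝ) + 1 + 1)) ht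
      (by positivity) (by linarith)).2
    push_cast
    rw [show 2 * ((n : ℝ) + 1 + 1) - 2 * (n + 1) = 2 by ring] at this
    linarith

lemma arctan_le_self_of_nonneg {u : ℝ} (hu : 0 ≤ u) : Real.arctan u ≤ u := by
  have := (arctan_incr le_rfl hu).2
  simpa using this

/-- The approximating function is within `2` of `|t|`. -/
lemma approx_abs (t : ℝ) (n : ℕ) (hn : t ^ 2 ≤ 2 * ((n : ℝ) + 1)) :
    |(|t|) - ∑ k ∈ Finset.range n,
      4 / Real.pi * (t ^ 2 / (t ^ 2 + (2 * ((k : ℝ) + 1)) ^ 2))| ≤ 2 := by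
  rcases eq_or_ne t 0 with rfl | h0
  · simp
  have ht : 0 < |t| := abs_pos.mpr h0
  rw [← sq_abs t] at hn ⊢
  set u := |t|
  have e : ∑ k ∈ Finset.range n, 4 / Real.pi * (u ^ 2 / (u ^ 2 + (2 * ((k : ℝ) + 1)) ^ 2)) =
      2 * u / Real.pi * ∑ k ∈ Finset.range n, 2 * (u / (u ^ 2 + (2 * ((k : ℝ) + 1)) ^ 2)) := by
    rw [Finset.mul_sum]
    refine Finset.sum_congr rfl fun k _ => ?_
    ring
  rw [e]
  have h1 := sum_upper ht n
  have h2 := sum_lower ht n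
  have h3 := (Real.arctan_lt_pi_div_two (2 * (n : ℝ) / u)).le
  have h4 : Real.arctan (2 / u) ≤ 2 / u := arctan_le_self_of_nonneg (by positivity)
  have h5 : Real.arctan (u / (2 * ((n : ℝ) + 1))) ≤ u / (2 * ((n : ℝ) + 1)) :=
    arctan_le_self_of_nonneg (by positivity)
  have h6 := Real.arctan_inv_of_pos (x := u / (2 * ((n : ℝ) + 1))) (by positivity)
  rw [inv_div] at h6
  set S := ∑ k ∈ Finset.range n, 2 * (u / (u ^ 2 + (2 * ((k : ℝ) + 1)) ^ 2))
  have hpi := Real.pi_gt_three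
  have hpos : 0 < 2 * u / Real.pi := by positivity
  have a1 : 2 * u / Real.pi * S ≤ u := by
    calc _ ≤ 2 * u / Real.pi * (Real.pi / 2) := by gcongr; linarith
      _ = u := by field_simp
  have a2 : u - 2 ≤ 2 * u / Real.pi * S := by
    have b1 : Real.pi / 2 - (u / (2 * ((n : ℝ) + 1)) + 2 / u) ≤ S := by linarith
    have b2 : 2 * u / Real.pi * (Real.pi / 2 - (u / (2 * ((n : ℝ) + 1)) + 2 / u)) ≤
        2 * u / Real.pi * S := by gcongr
    have b3 : 2 * u / Real.pi * (Real.pi / 2 - (u / (2 * ((n : ℝ) + 1)) + 2 / u)) =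
        u - 2 / Real.pi * (u ^ 2 / (2 * ((n : ℝ) + 1)) + 2) := by field_simp
    have b4 : u ^ 2 / (2 * ((n : ℝ) + 1)) ≤ 1 := by
      rw [div_le_one (by positivity)]; exact hn
    have b5 : 2 / Real.pi ≤ 2 / 3 := by gcongr
    have b6 : 2 / Real.pi * (u ^ 2 / (2 * ((n : ℝ) + 1)) + 2) ≤ 2 / 3 * (1 + 2) := by gcongr
    linarith
  rw [abs_le]
  constructor <;> linarith

/-- Bound for the derivative of the approximating function. -/
lemma approx_deriv (t : ℝ) (n : ℕ) :
    |∑ k ∈ Finset.range n, 4 / Real.pi * (2 * (2 * ((k : ℝ) + 1)) ^ 2 * t /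
      (t ^ 2 + (2 * ((k : ℝ) + 1)) ^ 2) ^ 2)| ≤ 4 := by
  rcases eq_or_ne t 0 with rfl | h0
  · simp
  have ht : 0 < |t| := abs_pos.mpr h0
  refine (Finset.abs_sum_le_sum_abs _ _).trans ?_
  have h1 := sum_upper ht n
  have h3 := (Real.arctan_lt_pi_div_two (2 * (n : ℝ) / |t|)).le
  have hpi := Real.pi_pos
  calc _ ≤ ∑ k ∈ Finset.range n, 4 / Real.pi *
        (2 * (|t| / (|t| ^ 2 + (2 * ((k : ℝ) + 1)) ^ 2))) := by
        refine Finset.sum_le_sum fun k _ => ?_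
        rw [abs_mul, abs_of_pos (show 0 < 4 / Real.pi by positivity)]
        gcongr
        rw [sq_abs, abs_div, abs_mul, abs_of_pos (show 0 < 2 * (2 * ((k : ℝ) + 1)) ^ 2 by positivity),
          abs_of_pos (show 0 < (t ^ 2 + (2 * ((k : ℝ) + 1)) ^ 2) ^ 2 by positivity)]
        set s := 2 * ((k : ℝ) + 1) with hs
        have hs0 : 0 < s := by positivity
        rw [show 2 * (|t| / (t ^ 2 + s ^ 2)) = 2 * (t ^ 2 + s ^ 2) * |t| / (t ^ 2 + s ^ 2) ^ 2 by
          field_simp]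
        gcongr
        nlinarith [sq_nonneg t]
    _ = 4 / Real.pi * ∑ k ∈ Finset.range n,
        (2 * (|t| / (|t| ^ 2 + (2 * ((k : ℝ) + 1)) ^ 2))) := by rw [Finset.mul_sum]
    _ ≤ 4 / Real.pi * (Real.pi / 2) := by gcongr; linarith
    _ ≤ 4 := by field_simp; norm_num

lemma sum_inv_sq (n : ℕ) : ∑ k ∈ Finset.range n, 1 / ((k : ℝ) + 1) ^ 2 ≤ 2 - 1 / (n : ℝ) := by
  induction n with
  | zero => simp
  | succ n ih =>
    rw [Finset.sum_range_succ]
    rcases Nat.eq_zero_or_pos n with rfl | hn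
    · norm_num
    have hn' : (0 : ℝ) < n := by exact_mod_cast hn
    have : 1 / ((n : ℝ) + 1) ^ 2 ≤ 1 / (n : ℝ) - 1 / (n + 1) := by
      rw [div_sub_div _ _ (by positivity) (by positivity)]
      rw [div_le_div_iff₀ (by positivity) (by positivity)]
      nlinarith
    push_cast
    linarith

section alg
variable {A : Type*} [Ring A] [Algebra ℝ A]

lemma comm_resolvent (D R z : A) (c : ℝ) (h1 : R * (D * D) = 1 - c • R)
    (h2 : D * D * R = 1 - c • R) :
    z * R - R * z = R * (D * D * z - z * (D * D)) * R := by
  have : R * (D * D * z - z * (D * D)) * R = (R * (D * D)) * z * R - R * z * (D * D * R) := by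
    noncomm_ring
  rw [this, h1, h2]
  simp only [sub_mul, mul_sub, smul_mul_assoc, mul_smul_comm, one_mul, mul_one]
  abel

lemma comm_identity (D R y d e : A) (c : ℝ) (h1 : R * (D * D) = 1 - c • R)
    (h2 : D * D * R = 1 - c • R) (h3 : R * D = D * R)
    (hd : d = D * y - y * D) (he : e = D * d - d * D) :
    (1 - c • R) * y - y * (1 - c • R) - ((2 * c) • (D * R * R)) * d =
      c • ((2 : ℝ) • (D * R * (D * R) * e * R) + (2 : ℝ) • (D * R * R * e * (D * R)) - R * e * R) := by
  have k1 := comm_resolvent D R y c h1 h2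
  have k2 := comm_resolvent D R d c h1 h2
  have e1 : D * D * y - y * (D * D) = (2 : ℝ) • (D * d) - e := by
    rw [he, hd, two_smul]; noncomm_ring
  have e2 : D * D * d - d * (D * D) = D * e + e * D := by
    rw [he]; noncomm_ring
  rw [e1] at k1
  rw [e2] at k2
  have k3 : d * R = R * d + R * (D * e + e * D) * R := by rw [← k2]; abel
  have k4 : y * R - R * y = (2 : ℝ) • (D * R * (d * R)) - R * e * R := by
    rw [k1, ← h3]
    simp only [mul_sub, sub_mul, mul_smul_comm, smul_mul_assoc, mul_assoc]
  have k5 : (1 - c • R) * y - y * (1 - c • R) = c • (y * R - R * y) := by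
    simp only [sub_mul, mul_sub, smul_mul_assoc, mul_smul_comm, one_mul, mul_one, smul_sub]
    abel
  have k6 : D * R * (d * R) = D * R * R * d + D * R * (D * R) * e * R + D * R * R * e * (D * R) := by
    rw [k3]
    have : D * R * (D * R) * e * R = D * R * (R * D) * e * R := by rw [h3]
    rw [this]
    noncomm_ring
  rw [k5, k4, k6]
  simp only [smul_sub, smul_add, smul_mul_assoc, mul_smul, mul_assoc]
  module

end alg

section op
variable {H : Type*} [NormedAddCommGroup H] [InnerProductSpace ℂ H] [CompleteSpace H]

lemma term_estimate (D : H →L[ℂ] H) (hD : IsSelfAdjoint D) (y d e : H →L[ℂ] H)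
    (hd : d = D * y - y * D) (he : e = D * d - d * D) (s : ℝ) (hs : 0 < s) :
    ‖cfc (fun t : ℝ => t ^ 2 / (t ^ 2 + s ^ 2)) D * y -
        y * cfc (fun t : ℝ => t ^ 2 / (t ^ 2 + s ^ 2)) D -
        cfc (fun t : ℝ => 2 * s ^ 2 * t / (t ^ 2 + s ^ 2) ^ 2) D * d‖ ≤ 2 / s ^ 2 * ‖e‖ := by
  have hne : ∀ t : ℝ, t ^ 2 + s ^ 2 ≠ 0 := fun t => by positivity
  have hc : Continuous fun t : ℝ => 1 / (t ^ 2 + s ^ 2) := by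
    exact continuous_const.div (by fun_prop) hne
  set r : ℝ → ℝ := fun t => 1 / (t ^ 2 + s ^ 2) with hr
  set R := cfc r D with hR
  have hid : cfc (fun t : ℝ => t) D = D := cfc_id' ℝ D
  have hDR : D * R = cfc (fun t : ℝ => t * r t) D := by
    rw [cfc_mul (fun t : ℝ => t) r D (by fun_prop) hc.continuousOn, hid]
  have hRD : R * D = D * R := by
    rw [hDR, show (fun t : ℝ => t * r t) = fun t => r t * t by ext t; ring,
      cfc_mul r (fun t : ℝ => t) D hc.continuousOn (by fun_prop), hid]
  have hDDR : D * D * R = cfc (fun t : ℝ => t * (t * r t)) D := by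
    rw [mul_assoc, hDR, cfc_mul (fun t : ℝ => t) (fun t => t * r t) D (by fun_prop)
      (by fun_prop), hid]
  have hP : cfc (fun t : ℝ => t * (t * r t)) D = 1 - (s ^ 2) • R := by
    rw [show (fun t : ℝ => t * (t * r t)) = fun t => (1 : ℝ) - s ^ 2 • r t by
      ext t; simp only [hr, smul_eq_mul]; have := hne t; field_simp; ring]
    rw [cfc_sub (fun _ : ℝ => (1 : ℝ)) (fun t => s ^ 2 • r t) D (by fun_prop) (by fun_prop),
      cfc_smul (s ^ 2) r D (by fun_prop), cfc_const_one ℝ D]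
  have hP' : cfc (fun t : ℝ => t ^ 2 / (t ^ 2 + s ^ 2)) D = 1 - (s ^ 2) • R := by
    rw [← hP]; congr 1; ext t; simp only [hr]; ring
  have hQ : cfc (fun t : ℝ => 2 * s ^ 2 * t / (t ^ 2 + s ^ 2) ^ 2) D =
      (2 * s ^ 2) • (D * R * R) := by
    rw [show (fun t : ℝ => 2 * s ^ 2 * t / (t ^ 2 + s ^ 2) ^ 2) =
      fun t => (2 * s ^ 2) • ((t * r t) * r t) by
      ext t; simp only [hr, smul_eq_mul]; have := hne t; field_simp]
    rw [cfc_smul (2 * s ^ 2) (fun t => (t * r t) * r t) D (by fun_prop),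
      cfc_mul (fun t => t * r t) r D (by fun_prop) (by fun_prop), hDR]
  have h2 : D * D * R = 1 - (s ^ 2) • R := hDDR.trans hP
  have h1 : R * (D * D) = 1 - (s ^ 2) • R := by
    rw [← mul_assoc, hRD, mul_assoc, hRD, ← mul_assoc, h2]
  rw [hP', hQ, comm_identity D R y d e (s ^ 2) h1 h2 hRD hd he]
  have nR : ‖R‖ ≤ 1 / s ^ 2 := by
    refine norm_cfc_le (by positivity) fun t _ => ?_
    rw [Real.norm_eq_abs, abs_of_pos (by simp only [hr]; positivity)]
    simp only [hr]
    gcongr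
    nlinarith [sq_nonneg t]
  have nE : ‖D * R‖ ≤ 1 / (2 * s) := by
    rw [hDR]
    refine norm_cfc_le (by positivity) fun t _ => ?_
    rw [Real.norm_eq_abs, abs_mul, abs_of_pos (show 0 < r t by simp only [hr]; positivity)]
    simp only [hr]
    rw [mul_one_div, div_le_div_iff₀ (by positivity) (by positivity), ← sq_abs t]
    nlinarith [sq_nonneg (|t| - s)]
  set E := D * R
  have n1 : ‖E * E * e * R‖ ≤ 1 / (2 * s) * (1 / (2 * s)) * ‖e‖ * (1 / s ^ 2) := by
    refine (norm_mul_le _ _).trans ?_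
    gcongr
    refine (norm_mul_le _ _).trans ?_
    gcongr
    refine (norm_mul_le _ _).trans ?_
    gcongr
  have n2 : ‖E * R * e * E‖ ≤ 1 / (2 * s) * (1 / s ^ 2) * ‖e‖ * (1 / (2 * s)) := by
    refine (norm_mul_le _ _).trans ?_
    gcongr
    refine (norm_mul_le _ _).trans ?_
    gcongr
    refine (norm_mul_le _ _).trans ?_
    gcongr
  have n3 : ‖R * e * R‖ ≤ 1 / s ^ 2 * ‖e‖ * (1 / s ^ 2) := by
    refine (norm_mul_le _ _).trans ?_
    gcongr
    refine (norm_mul_le _ _).trans ?_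
    gcongr
  rw [norm_smul, Real.norm_of_nonneg (by positivity)]
  calc s ^ 2 * ‖(2 : ℝ) • (E * E * e * R) + (2 : ℝ) • (E * R * e * E) - R * e * R‖
      ≤ s ^ 2 * (2 * (1 / (2 * s) * (1 / (2 * s)) * ‖e‖ * (1 / s ^ 2)) +
        2 * (1 / (2 * s) * (1 / s ^ 2) * ‖e‖ * (1 / (2 * s))) +
        1 / s ^ 2 * ‖e‖ * (1 / s ^ 2)) := by
        gcongr
        refine (norm_sub_le _ _).trans (add_le_add ((norm_add_le _ _).trans (add_le_add ?_ ?_)) n3)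
        · rw [norm_smul, Real.norm_of_nonneg (by norm_num)]; gcongr
        · rw [norm_smul, Real.norm_of_nonneg (by norm_num)]; gcongr
    _ = 2 / s ^ 2 * ‖e‖ := by field_simp; ring

end op

/-- Proposition 7.1 of the paper (for a bounded self-adjoint `D`):
`‖[|D|, y]‖ ≤ 4‖y‖ + 4‖[D,y]‖ + 2‖[D,[D,y]]‖`, where `|D| = (D²)^{1/2}` is
given by the continuous functional calculus of `D` applied to `t ↦ |t|`. -/
theorem commutator_estimate_abs
    {H : Type*} [NormedAddCommGroup H] [InnerProductSpace ℂ H] [CompleteSpace H]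
    (D : H →L[ℂ] H) (hD : IsSelfAdjoint D) (y : H →L[ℂ] H) :
    ‖cfc (fun t : ℝ => |t|) D * y - y * cfc (fun t : ℝ => |t|) D‖ ≤
      4 * ‖y‖ + 4 * ‖D * y - y * D‖ +
        2 * ‖D * (D * y - y * D) - (D * y - y * D) * D‖ := by
  obtain ⟨d, hd⟩ : ∃ d, d = D * y - y * D := ⟨_, rfl⟩
  rw [← hd]
  obtain ⟨e, he⟩ : ∃ e, e = D * d - d * D := ⟨_, rfl⟩
  rw [← he]
  obtain ⟨n, hn⟩ := exists_nat_ge ((‖D‖ * ‖(1 : H →L[ℂ] H)‖) ^ 2)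
  have hpi := Real.pi_pos
  have hpi3 := Real.pi_gt_three
  set p : ℕ → ℝ → ℝ := fun k t => t ^ 2 / (t ^ 2 + (2 * ((k : ℝ) + 1)) ^ 2) with hp
  set q : ℕ → ℝ → ℝ := fun k t => 2 * (2 * ((k : ℝ) + 1)) ^ 2 * t /
      (t ^ 2 + (2 * ((k : ℝ) + 1)) ^ 2) ^ 2 with hq
  have cp : ∀ k, Continuous (p k) := fun k =>
    Continuous.div (by fun_prop) (by fun_prop) (fun t => by positivity)
  have cq : ∀ k, Continuous (q k) := fun k =>
    Continuous.div (by fun_prop) (by fun_prop) (fun t => by positivity)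
  set w := 4 / Real.pi with hw
  have hw0 : 0 < w := by positivity
  set F : H →L[ℂ] H := ∑ k ∈ Finset.range n, w • cfc (p k) D with hF
  set G : H →L[ℂ] H := ∑ k ∈ Finset.range n, w • cfc (q k) D with hG
  have hF' : F = cfc (fun t => ∑ k ∈ Finset.range n, w * p k t) D := by
    have := cfc_sum (fun k t => w • p k t) D (Finset.range n)
      (fun k _ => ((cp k).const_smul w).continuousOn)
    rw [hF]
    rw [Finset.sum_congr rfl fun k _ => (cfc_smul w (p k) D (cp k).continuousOn).symm, ← this]
    congr 1; ext t; simp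
  have hG' : G = cfc (fun t => ∑ k ∈ Finset.range n, w * q k t) D := by
    have := cfc_sum (fun k t => w • q k t) D (Finset.range n)
      (fun k _ => ((cq k).const_smul w).continuousOn)
    rw [hG]
    rw [Finset.sum_congr rfl fun k _ => (cfc_smul w (q k) D (cq k).continuousOn).symm, ← this]
    congr 1; ext t; simp
  have nG : ‖G‖ ≤ 4 := by
    rw [hG']
    exact norm_cfc_le (by norm_num) fun t _ => approx_deriv t n
  set B := cfc (fun t : ℝ => |t|) D with hB
  have nB : ‖B - F‖ ≤ 2 := by
    rw [hB, hF', ← cfc_sub (fun t : ℝ => |t|) (fun t => ∑ k ∈ Finset.range n, w * p k t) D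
      (by fun_prop) (by fun_prop)]
    refine norm_cfc_le (by norm_num) fun t ht => approx_abs t n ?_
    have h1 : ‖t‖ ≤ ‖D‖ * ‖(1 : H →L[ℂ] H)‖ := spectrum.norm_le_norm_mul_of_mem ht
    have h2 : t ^ 2 ≤ (‖D‖ * ‖(1 : H →L[ℂ] H)‖) ^ 2 := by
      rw [← sq_abs t]
      rw [Real.norm_eq_abs] at h1
      gcongr
    have : (0 : ℝ) ≤ n := n.cast_nonneg
    linarith
  have nF : ‖F * y - y * F - G * d‖ ≤ 2 * ‖e‖ := by
    have e1 : F * y - y * F - G * d = ∑ k ∈ Finset.range n,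
        w • (cfc (p k) D * y - y * cfc (p k) D - cfc (q k) D * d) := by
      rw [hF, hG]
      simp only [Finset.sum_mul, Finset.mul_sum, smul_sub, Finset.sum_sub_distrib,
        smul_mul_assoc, mul_smul_comm]
    rw [e1]
    calc _ ≤ ∑ k ∈ Finset.range n, w * (2 / (2 * ((k : ℝ) + 1)) ^ 2 * ‖e‖) := by
          refine norm_sum_le_of_le _ fun k _ => ?_
          rw [norm_smul, Real.norm_of_nonneg hw0.le]
          gcongr
          exact term_estimate D hD y d e hd he (2 * ((k : ℝ) + 1)) (by positivity)
      _ = w * (1 / 2) * ‖e‖ * ∑ k ∈ Finset.range n, 1 / ((k : ℝ) + 1) ^ 2 := by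
          rw [Finset.mul_sum]
          refine Finset.sum_congr rfl fun k _ => ?_
          field_simp
          try ring
      _ ≤ w * (1 / 2) * ‖e‖ * 2 := by
          gcongr
          have := sum_inv_sq n
          have h : (0 : ℝ) ≤ 1 / n := by positivity
          linarith
      _ = w * ‖e‖ := by ring
      _ ≤ 2 * ‖e‖ := by
          gcongr
          rw [hw, div_le_iff₀ hpi]
          linarith
  have e2 : B * y - y * B = ((B - F) * y - y * (B - F)) + G * d + (F * y - y * F - G * d) := by
    noncomm_ring
  rw [e2]
  have m1 : ‖(B - F) * y‖ ≤ 2 * ‖y‖ := (norm_mul_le _ _).trans (by gcongr)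
  have m2 : ‖y * (B - F)‖ ≤ ‖y‖ * 2 := (norm_mul_le _ _).trans (by gcongr)
  have m3 : ‖G * d‖ ≤ 4 * ‖d‖ := (norm_mul_le _ _).trans (by gcongr)
  have m4 := norm_sub_le ((B - F) * y) (y * (B - F))
  have m5 := norm_add₃_le (a := (B - F) * y - y * (B - F)) (b := G * d)
    (c := F * y - y * F - G * d)
  linarith
end

section
/- Let D be a bounded self-adjoint operator on a complex Hilbert space H, y a bounded operator on H, n ≥ 1 a natural number, and |D| the absolute value of D. Then ‖ad_{|D|}^n(y)‖ ≤ 2^n · (π/√3) · ‖y‖ + (π/√3) · ∑_{l=1}^{n+1} C(n+1, l) · 2^{n+1−l} · ‖ad_D^l(y)‖, where ad_T(y) = Ty − yT and ad_T^k denotes the k-fold iterated commutator. -/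
section helpers
variable {𝔅 : Type*} [CStarAlgebra 𝔅]

lemma exp_bd (D : 𝔅) (hD : IsSelfAdjoint D) (w : ℂ) (hw : w.re ≤ 0) :
    ‖NormedSpace.exp (w • cfc (fun t : ℝ => |t|) D)‖ ≤ 1 := by
  have hN : IsStarNormal D := hD.isStarNormal
  rw [cfc_real_eq_complex _ hD, ← cfc_smul _ _ _ (by fun_prop),
    ← CFC.exp_eq_normedSpace_exp (𝕜 := ℂ) (ha := cfc_predicate _ _),
    ← cfc_comp' _ _ _ (by fun_prop) (by fun_prop)]
  refine norm_cfc_le zero_le_one fun x hx => ?_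
  rw [← Complex.exp_eq_exp_ℂ, Complex.norm_exp]
  simp
  nlinarith [abs_nonneg x.re]

noncomputable def VV (a : 𝔅) : Module.End ℂ 𝔅 := LinearMap.mulLeft ℂ a - LinearMap.mulRight ℂ a
noncomputable def AA (a : 𝔅) : Module.End ℂ 𝔅 := LinearMap.mulLeft ℂ a + LinearMap.mulRight ℂ a

lemma VV_apply (a z : 𝔅) : VV a z = a * z - z * a := by simp [VV]
lemma AA_apply (a z : 𝔅) : AA a z = a * z + z * a := by simp [AA]

lemma VA_comm (a : 𝔅) : Commute (VV a) (AA a) := by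
  apply LinearMap.ext; intro z
  simp [VV_apply, AA_apply, mul_assoc, mul_add, mul_sub, add_mul, sub_mul]
  abel

lemma hd_exp (a : 𝔅) (x : ℂ) (α β : ℂ) :
    HasDerivAt (fun z : ℂ => NormedSpace.exp ((α * z + β) • a))
      (α • (NormedSpace.exp ((α * x + β) • a) * a)) x := by
  have h1 := hasDerivAt_exp_smul_const (𝕂 := ℂ) a (α * x + β)
  have h2 : HasDerivAt (fun z : ℂ => α * z + β) α x := by
    simpa using ((hasDerivAt_id x).const_mul α).add_const β
  exact h1.scomp x h2

lemma comm_exp (a : 𝔅) (w : ℂ) : NormedSpace.exp (w • a) * a = a * NormedSpace.exp (w • a) :=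
  (((Commute.refl a).smul_right w).exp_right).eq.symm

noncomputable def ff (a W : 𝔅) (x : ℂ) (z : ℂ) : 𝔅 :=
  NormedSpace.exp ((1 * z + -x) • a) * W * NormedSpace.exp ((-1 * z + -x) • a)

lemma ff_deriv (a W : 𝔅) (x z : ℂ) : HasDerivAt (ff a W x) (ff a (VV a W) x z) z := by
  have := ((hd_exp a z 1 (-x)).mul_const W).mul (hd_exp a z (-1) (-x))
  refine this.congr_deriv ?_
  simp only [ff, VV_apply, comm_exp a (-1 * z + -x)]
  simp [mul_assoc, mul_sub, sub_mul]
  abel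

lemma ff_iter (a : 𝔅) (x : ℂ) (n : ℕ) : ∀ W, iteratedDeriv n (ff a W x) = ff a ((VV a ^ n) W) x := by
  induction n with
  | zero => intro W; simp
  | succ n ih =>
    intro W
    rw [iteratedDeriv_succ', show deriv (ff a W x) = ff a (VV a W) x from
      funext fun z => (ff_deriv a W x z).deriv, ih]
    simp [pow_succ]

lemma cauchy (a : 𝔅) (ha : ∀ w : ℂ, w.re ≤ 0 → ‖NormedSpace.exp (w • a)‖ ≤ 1) (x : ℝ) (hx : 0 < x)
    (n : ℕ) (W : 𝔅) :
    ‖NormedSpace.exp ((-x : ℂ) • a) * (VV a ^ n) W * NormedSpace.exp ((-x : ℂ) • a)‖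
      ≤ n.factorial * ‖W‖ / x ^ n := by
  have hdiff : Differentiable ℂ (ff a W x) := fun z => (ff_deriv a W x z).differentiableAt
  have := Complex.norm_iteratedDeriv_le_of_forall_mem_sphere_norm_le (c := 0) (f := ff a W x)
    (C := ‖W‖) n hx hdiff.diffContOnCl ?_
  · rw [ff_iter] at this
    simpa [ff] using this
  · intro z hz
    have hz : ‖z‖ = x := by simpa using hz
    have h1 := Complex.re_le_norm z
    have h2 := Complex.abs_re_le_norm z
    have h3 := neg_abs_le z.re
    have e1 := ha (1 * z + -x) (by simp; linarith)
    have e2 := ha (-1 * z + -x) (by simp; linarith)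
    unfold ff
    calc _ ≤ ‖NormedSpace.exp ((1 * z + -x) • a)‖ * ‖W‖ * ‖NormedSpace.exp ((-1 * z + -x) • a)‖ :=
          (norm_mul_le _ _).trans (by gcongr; exact norm_mul_le _ _)
      _ ≤ 1 * ‖W‖ * 1 := by gcongr
      _ = _ := by ring

noncomputable def BB (a : 𝔅) : Module.End ℂ 𝔅 := AA a + (2 : ℂ) • 1

lemma BB_apply (a z : 𝔅) : BB a z = a * z + z * a + (2 : ℂ) • z := by simp [BB, AA_apply]

lemma VB_comm (a : 𝔅) : Commute (VV a) (BB a) :=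
  (VA_comm a).add_right ((Commute.one_right _).smul_right _)

noncomputable def pp (a W : 𝔅) (z : ℂ) : 𝔅 :=
  Complex.exp (-2 * z) • (NormedSpace.exp ((-1 * z + 0) • a) * W * NormedSpace.exp ((-1 * z + 0) • a))

lemma pp_deriv (a W : 𝔅) (z : ℂ) : HasDerivAt (pp a W) (-pp a (BB a W) z) z := by
  have h1 : HasDerivAt (fun z : ℂ => Complex.exp (-2 * z)) (Complex.exp (-2 * z) * (-2)) z := by
    simpa using ((hasDerivAt_id z).const_mul (-2)).cexp
  have := h1.smul (((hd_exp a z (-1) 0).mul_const W).mul (hd_exp a z (-1) 0))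
  refine this.congr_deriv ?_
  simp only [pp, BB_apply, mul_add, add_mul]
  nth_rw 2 [comm_exp a (-1 * z + 0)]
  simp [mul_assoc, mul_smul, smul_add]
  abel

lemma pp_norm (a : 𝔅) (ha : ∀ w : ℂ, w.re ≤ 0 → ‖NormedSpace.exp (w • a)‖ ≤ 1) (W : 𝔅) (x : ℝ)
    (hx : 0 ≤ x) : ‖pp a W x‖ ≤ Real.exp (-2 * x) * ‖W‖ := by
  have e := ha (-1 * x + 0) (by simpa using hx)
  unfold pp
  rw [norm_smul, Complex.norm_exp]
  have : (-2 * (x : ℂ)).re = -2 * x := by simp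
  rw [this]
  gcongr
  calc _ ≤ ‖NormedSpace.exp ((-1 * (x : ℂ) + 0) • a)‖ * ‖W‖ * ‖NormedSpace.exp ((-1 * (x : ℂ) + 0) • a)‖ :=
        (norm_mul_le _ _).trans (by gcongr; exact norm_mul_le _ _)
    _ ≤ 1 * ‖W‖ * 1 := by gcongr
    _ = _ := by ring

noncomputable def gg (a U : 𝔅) (n : ℕ) (z : ℂ) : 𝔅 :=
  -∑ k ∈ Finset.range (n + 1), (z ^ k / k.factorial) • pp a ((BB a ^ k) U) z

lemma gg_deriv (a U : 𝔅) (n : ℕ) (z : ℂ) :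
    HasDerivAt (gg a U n) ((z ^ n / n.factorial) • pp a ((BB a ^ (n + 1)) U) z) z := by
  induction n with
  | zero =>
    have := (pp_deriv a U z).neg
    have e : gg a U 0 = -pp a U := by funext z; simp [gg]
    rw [e]
    refine this.congr_deriv ?_
    simp
  | succ n ih =>
    have e : gg a U (n + 1) = gg a U n - fun z : ℂ => (z ^ (n + 1) / (n + 1).factorial) •
        pp a ((BB a ^ (n + 1)) U) z := by
      funext z; simp only [gg, Pi.sub_apply]; rw [Finset.sum_range_succ _ (n + 1)]; abel
    have h1 : HasDerivAt (fun z : ℂ => z ^ (n + 1) / ((n + 1).factorial : ℂ))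
        (z ^ n / n.factorial) z := by
      refine ((hasDerivAt_pow (n + 1) z).div_const _).congr_deriv ?_
      have : (n.factorial : ℂ) ≠ 0 := by exact_mod_cast n.factorial_ne_zero
      have h2 : ((n : ℂ) + 1) ≠ 0 := by exact_mod_cast n.succ_ne_zero
      rw [Nat.factorial_succ]; push_cast; field_simp
    rw [e]
    refine (ih.sub (h1.smul (pp_deriv a ((BB a ^ (n + 1)) U) z))).congr_deriv ?_
    rw [pow_succ' _ (n + 1), Module.End.mul_apply]
    simp

lemma key (a : 𝔅) (ha : ∀ w : ℂ, w.re ≤ 0 → ‖NormedSpace.exp (w • a)‖ ≤ 1) (X : 𝔅) (n : ℕ)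
    (hn : 1 ≤ n) : ‖(VV a ^ n) X‖ ≤ 1 / 2 * ‖(BB a ^ (n + 1)) X‖ := by
  set U := (VV a ^ n) X with hU
  set Y := (BB a ^ (n + 1)) X with hY
  have hBU : (BB a ^ (n + 1)) U = (VV a ^ n) Y := by
    rw [hU, hY, ← Module.End.mul_apply, ← Module.End.mul_apply, ((VB_comm a).pow_pow _ _).eq]
  have hd : ∀ t : ℝ, HasDerivAt (fun t : ℝ => gg a U n t - gg a U n (0 : ℝ))
      (((t : ℂ) ^ n / n.factorial) • pp a ((BB a ^ (n + 1)) U) t) t := fun t =>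
    (((gg_deriv a U n t).scomp t Complex.ofRealCLM.hasDerivAt).congr_deriv (by simp)).sub_const _
  have hb : ∀ t : ℝ, 0 ≤ t → ‖((t : ℂ) ^ n / n.factorial) • pp a ((BB a ^ (n + 1)) U) t‖
      ≤ Real.exp (-2 * t) * ‖Y‖ := by
    intro t ht
    rcases ht.eq_or_lt with rfl | ht
    · have : n ≠ 0 := by omega
      simp [this]
    · have hc := cauchy a ha t ht n Y
      rw [hBU, norm_smul, pp, norm_smul, Complex.norm_exp]
      have e1 : (-2 * (t : ℂ)).re = -2 * t := by simp
      have e2 : ‖(t : ℂ) ^ n / n.factorial‖ = t ^ n / n.factorial := by simp [abs_of_pos ht]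
      have e3 : (-1 * (t : ℂ) + 0) = -t := by ring
      rw [e1, e2, e3]
      have hf : (0 : ℝ) < n.factorial := by exact_mod_cast n.factorial_pos
      calc _ ≤ t ^ n / n.factorial * (Real.exp (-2 * t) * (n.factorial * ‖Y‖ / t ^ n)) := by gcongr
        _ = _ := by field_simp
  have hmv : ∀ x : ℝ, 0 ≤ x → ‖gg a U n x - gg a U n (0 : ℝ)‖ ≤ (1 - Real.exp (-2 * x)) / 2 * ‖Y‖ := by
    intro x hx
    have hB : ∀ t : ℝ, HasDerivAt (fun t : ℝ => (1 - Real.exp (-2 * t)) / 2 * ‖Y‖)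
        (Real.exp (-2 * t) * ‖Y‖) t := by
      intro t
      have h1 : HasDerivAt (fun t : ℝ => Real.exp (-2 * t)) (Real.exp (-2 * t) * (-2)) t := by
        simpa using ((hasDerivAt_id t).const_mul (-2)).exp
      refine (((h1.const_sub 1).div_const 2).mul_const ‖Y‖).congr_deriv ?_
      ring
    refine image_norm_le_of_norm_deriv_right_le_deriv_boundary (a := 0) (b := x)
      (f := fun t : ℝ => gg a U n t - gg a U n (0 : ℝ))
      (fun t _ => (hd t).continuousAt.continuousWithinAt) (fun t _ => (hd t).hasDerivWithinAt)
      (B := fun t : ℝ => (1 - Real.exp (-2 * t)) / 2 * ‖Y‖) (by simp) hB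
      (fun t ht => hb t ht.1) ⟨hx, le_rfl⟩
  have h0 : gg a U n (0 : ℝ) = -U := by
    unfold gg
    rw [Finset.sum_eq_single 0]
    · simp [pp]
    · intro k _ hk; simp [hk]
    · simp
  have hlim : Filter.Tendsto (fun x : ℝ => ‖gg a U n x‖) Filter.atTop (nhds 0) := by
    have hT : Filter.Tendsto (fun x : ℝ => ∑ k ∈ Finset.range (n + 1),
        (x ^ k * Real.exp (-x)) * (‖(BB a ^ k) U‖ / k.factorial)) Filter.atTop (nhds 0) := by
      have := tendsto_finsetSum (Finset.range (n + 1)) (fun k _ =>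
        (Real.tendsto_pow_mul_exp_neg_atTop_nhds_zero k).mul_const (‖(BB a ^ k) U‖ / k.factorial))
      simpa using this
    refine squeeze_zero' (Filter.Eventually.of_forall fun _ => norm_nonneg _) ?_ hT
    filter_upwards [Filter.eventually_ge_atTop 0] with x hx
    unfold gg
    rw [norm_neg]
    refine norm_sum_le_of_le _ fun k _ => ?_
    rw [norm_smul]
    have e2 : ‖(x : ℂ) ^ k / k.factorial‖ = x ^ k / k.factorial := by simp [abs_of_nonneg hx]
    rw [e2]
    calc _ ≤ x ^ k / k.factorial * (Real.exp (-2 * x) * ‖(BB a ^ k) U‖) := by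
          gcongr; exact pp_norm a ha _ x hx
      _ ≤ x ^ k / k.factorial * (Real.exp (-x) * ‖(BB a ^ k) U‖) := by
          gcongr; linarith
      _ = _ := by ring
  have hlim2 : Filter.Tendsto (fun x : ℝ => 1 / 2 * ‖Y‖ + ‖gg a U n x‖) Filter.atTop
      (nhds (1 / 2 * ‖Y‖)) := by simpa using hlim.const_add (1 / 2 * ‖Y‖)
  refine ge_of_tendsto hlim2 ?_
  filter_upwards [Filter.eventually_ge_atTop 0] with x hx
  have h1 := hmv x hx
  rw [h0, sub_neg_eq_add] at h1
  have h2 : ‖U‖ ≤ ‖gg a U n x + U‖ + ‖gg a U n x‖ := by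
    have := norm_sub_le (gg a U n x + U) (gg a U n x)
    simpa using this
  have h3 : (1 - Real.exp (-2 * x)) / 2 * ‖Y‖ ≤ 1 / 2 * ‖Y‖ := by
    gcongr; linarith [Real.exp_pos (-2 * x)]
  linarith

lemma exists_sign {H : Type*} [NormedAddCommGroup H] [InnerProductSpace ℂ H] [CompleteSpace H]
    (D : H →L[ℂ] H) (hD : IsSelfAdjoint D) :
    ∃ J : H →L[ℂ] H, J * J = 1 ∧ ‖J‖ ≤ 1 ∧ J * D = cfc (fun t : ℝ => |t|) D ∧
      D * J = cfc (fun t : ℝ => |t|) D := by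
  set a := cfc (fun t : ℝ => |t|) D with ha
  have hsa : IsSelfAdjoint a := cfc_predicate _ _
  have hz : (a - D) * (a + D) = 0 := by
    have h1 : a - D = cfc (fun t : ℝ => |t| - t) D := by
      rw [cfc_sub (fun t : ℝ => |t|) (fun t => t) D, cfc_id' ℝ D]
    have h2 : a + D = cfc (fun t : ℝ => |t| + t) D := by
      rw [cfc_add D (fun t : ℝ => |t|) (fun t => t), cfc_id' ℝ D]
    rw [h1, h2, ← cfc_mul _ _ D (by fun_prop) (by fun_prop)]
    rw [show (fun t : ℝ => (|t| - t) * (|t| + t)) = fun _ => 0 by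
      funext t; nlinarith [sq_abs t]]
    simp
  let K : Submodule ℂ H := (a - D).ker
  have hKc : IsClosed (K : Set H) := (a - D).isClosed_ker
  have : CompleteSpace K := hKc.completeSpace_coe
  let P := K.starProjection
  have hP : star P = P := isSelfAdjoint_starProjection K
  have hPP : P * P = P := K.isIdempotentElem_starProjection
  have e1 : (a - D) * P = 0 := by
    ext v
    have : P v ∈ K := by simp [P]
    simpa [K] using this
  have e2 : P * (a + D) = a + D := by
    ext v
    have : (a + D) v ∈ K := by
      have := congrArg (fun T : H →L[ℂ] H => T v) hz
      simpa [K] using this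
    exact Submodule.starProjection_eq_self_iff.mpr this
  have e3 : P * (a - D) = 0 := by
    simpa [hP, hsa.star_eq, hD.star_eq] using congrArg star e1
  have e4 : (a + D) * P = a + D := by
    simpa [hP, hsa.star_eq, hD.star_eq] using congrArg star e2
  have hJ : (P + P - 1) * (P + P - 1) = 1 := by
    simp only [mul_add, add_mul, mul_sub, sub_mul, hPP, mul_one, one_mul]; abel
  have hJs : star (P + P - 1) = P + P - 1 := by simp [hP]
  refine ⟨P + P - 1, hJ, ?_, ?_, ?_⟩
  · have h := CStarRing.norm_star_mul_self (x := P + P - 1)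
    rw [hJs, hJ] at h
    have h1 : ‖(1 : H →L[ℂ] H)‖ ≤ 1 := ContinuousLinearMap.norm_id_le
    nlinarith [norm_nonneg (P + P - 1)]
  · have : (P + P - 1) * D = P * (a + D) - P * (a - D) - D := by
      simp only [mul_add, add_mul, mul_sub, sub_mul, one_mul]; abel
    rw [this, e2, e3]; abel
  · have : D * (P + P - 1) = (a + D) * P - (a - D) * P - D := by
      simp only [mul_add, add_mul, mul_sub, sub_mul, mul_one]; abel
    rw [this, e4, e1]; abel

/-- off-diagonal: `a`-anticommutator powers -/
lemma off_pow (J D a : 𝔅) (h1 : J * D = a) (h2 : D * J = a) (l : ℕ) :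
    ∀ X : 𝔅, J * X = -(X * J) → (AA a ^ l) X = J ^ l * (VV D ^ l) X := by
  induction l with
  | zero => intro X _; simp
  | succ l ih =>
    intro X hX
    have hA : AA a X = J * VV D X := by
      rw [AA_apply, VV_apply, mul_sub, ← mul_assoc, h1, ← mul_assoc, hX, neg_mul, mul_assoc, h1]
      abel
    have hV : ∀ (k : ℕ) Z, (VV D ^ k) (J * Z) = J * (VV D ^ k) Z := by
      intro k
      induction k with
      | zero => intro Z; simp
      | succ k ihk =>
        intro Z
        rw [pow_succ, Module.End.mul_apply, Module.End.mul_apply, ← ihk, VV_apply, VV_apply, mul_sub,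
          ← mul_assoc, ← mul_assoc, ← mul_assoc, h1, h2]
    have hX2 : J * (AA a X) = -(AA a X * J) := by
      have hJa : J * a = a * J := by rw [← h2, ← mul_assoc, h1, h2]
      rw [AA_apply, mul_add, ← mul_assoc, hJa, mul_assoc, hX, ← mul_assoc, hX, add_mul]
      simp [mul_assoc, hJa, add_comm]
    rw [pow_succ, Module.End.mul_apply, ih _ hX2, hA, hV, ← mul_assoc, ← pow_succ,
      pow_succ (VV D), Module.End.mul_apply]

lemma diag_pow (J D a : 𝔅) (h1 : J * D = a) (h2 : D * J = a) (l : ℕ) :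
    ∀ X : 𝔅, J * X = X * J → (VV a ^ l) X = J ^ l * (VV D ^ l) X := by
  induction l with
  | zero => intro X _; simp
  | succ l ih =>
    intro X hX
    have hA : VV a X = J * VV D X := by
      rw [VV_apply, VV_apply, mul_sub, ← mul_assoc, h1, ← mul_assoc, hX, mul_assoc, h1]
    have hV : ∀ (k : ℕ) Z, (VV D ^ k) (J * Z) = J * (VV D ^ k) Z := by
      intro k
      induction k with
      | zero => intro Z; simp
      | succ k ihk =>
        intro Z
        rw [pow_succ, Module.End.mul_apply, Module.End.mul_apply, ← ihk, VV_apply, VV_apply, mul_sub,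
          ← mul_assoc, ← mul_assoc, ← mul_assoc, h1, h2]
    have hX2 : J * (VV a X) = VV a X * J := by
      have hJa : J * a = a * J := by rw [← h2, ← mul_assoc, h1, h2]
      rw [VV_apply, mul_sub, ← mul_assoc, hJa, mul_assoc, hX, ← mul_assoc J X a, hX, sub_mul]
      simp [mul_assoc, hJa]
    rw [pow_succ, Module.End.mul_apply, ih _ hX2, hA, hV, ← mul_assoc, ← pow_succ,
      pow_succ (VV D), Module.End.mul_apply]

lemma VV_conj (J D : 𝔅) (h : J * D = D * J) (l : ℕ) :
    ∀ y, (VV D ^ l) (J * y * J) = J * (VV D ^ l) y * J := by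
  induction l with
  | zero => intro y; simp
  | succ l ih =>
    intro y
    rw [pow_succ, Module.End.mul_apply, Module.End.mul_apply, ← ih, VV_apply, VV_apply]
    congr 1
    rw [mul_sub, sub_mul]
    simp only [← mul_assoc, h]
    simp only [mul_assoc, h]

lemma norm_Jpow_mul (J : 𝔅) (hJ : ‖J‖ ≤ 1) (l : ℕ) (Z : 𝔅) : ‖J ^ l * Z‖ ≤ ‖Z‖ := by
  induction l with
  | zero => simp
  | succ l ih =>
    rw [pow_succ', mul_assoc]
    calc _ ≤ ‖J‖ * ‖J ^ l * Z‖ := norm_mul_le _ _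
      _ ≤ 1 * ‖Z‖ := by gcongr
      _ = _ := one_mul _

lemma norm_conj_le (J : 𝔅) (hJ : ‖J‖ ≤ 1) (Z : 𝔅) : ‖J * Z * J‖ ≤ ‖Z‖ := by
  calc _ ≤ ‖J‖ * ‖Z‖ * ‖J‖ := (norm_mul_le _ _).trans (by gcongr; exact norm_mul_le _ _)
    _ ≤ 1 * ‖Z‖ * 1 := by gcongr
    _ = _ := by ring

lemma norm_half (u v : 𝔅) (c : ℝ) (hu : ‖u‖ ≤ c) (hv : ‖v‖ ≤ c) :
    ‖(2⁻¹ : ℂ) • (u - v)‖ ≤ c ∧ ‖(2⁻¹ : ℂ) • (u + v)‖ ≤ c := by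
  constructor <;> rw [norm_smul] <;> norm_num
  · linarith [norm_sub_le u v]
  · linarith [norm_add_le u v]

lemma final (J D a y : 𝔅) (hJJ : J * J = 1) (hJ : ‖J‖ ≤ 1) (h1 : J * D = a) (h2 : D * J = a)
    (ha : ∀ w : ℂ, w.re ≤ 0 → ‖NormedSpace.exp (w • a)‖ ≤ 1) (n : ℕ) (hn : 1 ≤ n) :
    ‖(VV a ^ n) y‖ ≤ ‖(VV D ^ n) y‖ + 1 / 2 * ∑ l ∈ Finset.range (n + 2),
      ((n + 1).choose l : ℝ) * 2 ^ (n + 1 - l) * ‖(VV D ^ l) y‖ := by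
  set X := (2⁻¹ : ℂ) • (y - J * y * J) with hX
  set Z := (2⁻¹ : ℂ) • (y + J * y * J) with hZ
  have hy : y = Z + X := by rw [hX, hZ, ← smul_add]; simp [← two_smul ℂ y, smul_smul]
  have hJX : J * X = -(X * J) := by
    rw [hX, mul_smul_comm, smul_mul_assoc, ← smul_neg, mul_sub, sub_mul]
    simp [mul_assoc, hJJ]
    simp [← mul_assoc, hJJ]
  have hJZ : J * Z = Z * J := by
    rw [hZ, mul_smul_comm, smul_mul_assoc, mul_add, add_mul]
    simp [mul_assoc, hJJ]
    simp [← mul_assoc, hJJ, add_comm]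
  have hb : ∀ l, ‖(VV D ^ l) X‖ ≤ ‖(VV D ^ l) y‖ ∧ ‖(VV D ^ l) Z‖ ≤ ‖(VV D ^ l) y‖ := by
    intro l
    rw [hX, hZ, map_smul, map_smul, map_sub, map_add, VV_conj J D (h1.trans h2.symm)]
    exact norm_half _ _ _ le_rfl (norm_conj_le J hJ _)
  have hd : ‖(VV a ^ n) Z‖ ≤ ‖(VV D ^ n) y‖ := by
    rw [diag_pow J D a h1 h2 n Z hJZ]
    exact (norm_Jpow_mul J hJ _ _).trans (hb n).2
  have hbin : ‖(BB a ^ (n + 1)) X‖ ≤ ∑ l ∈ Finset.range (n + 2),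
      ((n + 1).choose l : ℝ) * 2 ^ (n + 1 - l) * ‖(VV D ^ l) y‖ := by
    have hc : Commute (AA a) ((2 : ℂ) • (1 : Module.End ℂ 𝔅)) := (Commute.one_right _).smul_right _
    rw [BB, hc.add_pow, LinearMap.sum_apply]
    refine norm_sum_le_of_le _ fun l _ => ?_
    have : (AA a ^ l * ((2 : ℂ) • (1 : Module.End ℂ 𝔅)) ^ (n + 1 - l) * ((n + 1).choose l : Module.End ℂ 𝔅)) X
        = (((n + 1).choose l : ℂ) * 2 ^ (n + 1 - l)) • (AA a ^ l) X := by
      rw [smul_pow, one_pow, ← nsmul_one ((n + 1).choose l), ← Nat.cast_smul_eq_nsmul ℂ]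
      simp [smul_smul]
    rw [this, off_pow J D a h1 h2 l X hJX, norm_smul]
    have e : ‖(((n + 1).choose l : ℂ) * 2 ^ (n + 1 - l))‖ = ((n + 1).choose l : ℝ) * 2 ^ (n + 1 - l) := by
      simp
    rw [e]
    gcongr
    exact (norm_Jpow_mul J hJ _ _).trans (hb l).1
  have ho := key a ha X n hn
  calc _ = ‖(VV a ^ n) Z + (VV a ^ n) X‖ := by rw [← map_add, ← hy]
    _ ≤ _ := norm_add_le _ _
    _ ≤ _ := by linarith

end helpers

/-- Theorem 7.2 of the paper (for a bounded self-adjoint `D`): for `n ≥ 1`,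
`‖ad_{|D|}^n(y)‖ ≤ 2^n (π/√3) ‖y‖ + (π/√3) ∑_{l=1}^{n+1} C(n+1,l) 2^{n+1−l} ‖ad_D^l(y)‖`,
where `|D|` is given by the continuous functional calculus of `D` applied to
`t ↦ |t|` and `ad_T(y) = Ty − yT`. -/
theorem iterated_commutator_estimate_abs
    {H : Type*} [NormedAddCommGroup H] [InnerProductSpace ℂ H] [CompleteSpace H]
    (D : H →L[ℂ] H) (hD : IsSelfAdjoint D) (y : H →L[ℂ] H)
    (n : ℕ) (hn : 1 ≤ n) :
    ‖(fun z => cfc (fun t : ℝ => |t|) D * z - z * cfc (fun t : ℝ => |t|) D)^[n] y‖ ≤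
      2 ^ n * (Real.pi / Real.sqrt 3) * ‖y‖ +
        (Real.pi / Real.sqrt 3) *
          ∑ l ∈ Finset.Icc 1 (n + 1),
            ((n + 1).choose l : ℝ) * 2 ^ (n + 1 - l) * ‖(fun z => D * z - z * D)^[l] y‖ := by
  obtain ⟨J, hJJ, hJ, h1, h2⟩ := exists_sign D hD
  have hf := final J D _ y hJJ hJ h1 h2 (fun w hw => exp_bd D hD w hw) n hn
  have hconv : ∀ (T : H →L[ℂ] H) (k : ℕ), (fun z => T * z - z * T)^[k] y = (VV T ^ k) y := by
    intro T k
    rw [Module.End.pow_apply]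
    congr 2
  simp only [hconv]
  have hK : 3 / 2 ≤ Real.pi / Real.sqrt 3 := by
    rw [le_div_iff₀ (by positivity)]
    have h3 : Real.sqrt 3 ≤ 2 := by rw [Real.sqrt_le_left (by norm_num)]; norm_num
    linarith [Real.pi_gt_three]
  set K := Real.pi / Real.sqrt 3
  set F : ℕ → ℝ := fun l => ((n + 1).choose l : ℝ) * 2 ^ (n + 1 - l) * ‖(VV D ^ l) y‖ with hF
  have hF0 : ∀ l, 0 ≤ F l := fun l => by positivity
  have hsum : ∑ l ∈ Finset.range (n + 2), F l = F 0 + ∑ l ∈ Finset.Icc 1 (n + 1), F l := by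
    rw [Finset.range_eq_Ico, Finset.sum_eq_sum_Ico_succ_bot (by omega)]
    rfl
  have hF0v : F 0 = 2 ^ (n + 1) * ‖y‖ := by simp [hF]
  have hn2 : ‖(VV D ^ n) y‖ ≤ ∑ l ∈ Finset.Icc 1 (n + 1), F l := by
    refine le_trans ?_ (Finset.single_le_sum (f := F) (fun l _ => hF0 l)
      (Finset.mem_Icc.mpr ⟨hn, Nat.le_succ n⟩))
    have : F n = ((n : ℝ) + 1) * 2 * ‖(VV D ^ n) y‖ := by simp [hF]
    rw [this]
    have : (0 : ℝ) ≤ n := n.cast_nonneg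
    nlinarith [norm_nonneg ((VV D ^ n) y), mul_nonneg this (norm_nonneg ((VV D ^ n) y))]
  set S := ∑ l ∈ Finset.Icc 1 (n + 1), F l
  rw [hsum, hF0v] at hf
  have hS : 0 ≤ S := Finset.sum_nonneg fun l _ => hF0 l
  have hp : (0 : ℝ) ≤ 2 ^ n * ‖y‖ := by positivity
  rw [pow_succ] at hf
  nlinarith [mul_le_mul_of_nonneg_right hK hS, mul_le_mul_of_nonneg_right hK hp]
end
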